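/- arXiv:1907.04588 — 8 statements merged into one kernel-verified Lean document; each statement's English description precedes it below -/
import Mathlib

section
/- Let m and n be positive integers with mn ≡ 4 (mod 8) such that m and n are not both even, and let λ_a ∈ {2,3}. Then every (m,n,3,λ_a,1)-OOSPC has at most ⌊(7mn+4+16ω)/32⌋ codewords. -/
open Finset

/-- An (m,n,k,lamA,lamC)-OOSPC: a family of k-subsets of Z_m x Z_n with
auto-correlation at most lamA and cross-correlation at most lamC. -/
def OOSPC (m n k lamA lamC : ℕ) (F : Finset (Finset (ZMod m × ZMod n))) : Prop :=
  (∀ X ∈ F, X.card = k) ∧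
  (∀ X ∈ F, ∀ g : ZMod m × ZMod n, g ≠ 0 →
    (X ∩ X.image (fun x => g + x)).card ≤ lamA) ∧
  (∀ X ∈ F, ∀ Y ∈ F, X ≠ Y → ∀ g : ZMod m × ZMod n,
    (X ∩ Y.image (fun x => g + x)).card ≤ lamC)

/-- The leave of a family: nonzero elements of Z_m x Z_n not occurring as a
difference of two elements of a member of the family. -/
def leave (m n : ℕ) (F : Finset (Finset (ZMod m × ZMod n))) : Set (ZMod m × ZMod n) :=
  {g | g ≠ 0 ∧ ∀ X ∈ F, ∀ x ∈ X, ∀ y ∈ X, x - y ≠ g}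

/-- (s,t)-regularity: the leave together with 0 equals S × T, where S and T are the
unique subgroups of order s of Z_m and of order t of Z_n (for s ∣ m, t ∣ n these are
exactly the elements killed by s, resp. t). -/
def Regular (m n s t : ℕ) (F : Finset (Finset (ZMod m × ZMod n))) : Prop :=
  insert (0 : ZMod m × ZMod n) (leave m n F) =
    {p : ZMod m × ZMod n | s • p.1 = 0 ∧ t • p.2 = 0}

/-- ξ: the number of subgroups of order 3 in Z_m × Z_n. -/
def xi (m n : ℕ) : ℕ := if 3 ∣ m ∧ 3 ∣ n then 4 else if 3 ∣ m * n then 1 else 0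

/-- ω = 0 if lamA = 2, and ω = ξ if lamA = 3. -/
def omega (lamA m n : ℕ) : ℕ := if lamA = 2 then 0 else xi m n

/-- The weight of a nonzero element lying over a class of `ZMod 4`, in general position. -/
def classWeight (i : ZMod 4) : ℕ := if i = 0 then 2 else if i = 2 then 3 else 1

lemma four_mul_sum_classWeight {G : Type*} [AddCommGroup G] [Fintype G] {φ : G →+ ZMod 4}
    {e : G} (he : φ e = 1) :
    4 * ∑ x, classWeight (φ x) = 7 * Fintype.card G := by
  have shift : ∀ a : G, ∑ x, classWeight (φ a + φ x) = ∑ x, classWeight (φ x) := by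
    intro a
    simpa using Equiv.sum_comp (Equiv.addLeft a) fun x => classWeight (φ x)
  have key : ∀ i : ZMod 4, classWeight i + classWeight (1 + i) + classWeight (1 + 1 + i) +
      classWeight (1 + 1 + 1 + i) = 7 := by decide
  have h : ∑ x, (classWeight (φ x) + classWeight (1 + φ x) + classWeight (1 + 1 + φ x) +
      classWeight (1 + 1 + 1 + φ x)) = 7 * Fintype.card G := by
    simp_rw [key]
    simp [mul_comm]
  have h1 := shift e
  have h2 := shift (e + e)
  have h3 := shift (e + e + e)
  simp only [map_add, he] at h1 h2 h3
  simp only [sum_add_distrib] at h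
  omega

section Weighting

variable {G : Type*} [AddCommGroup G] [DecidableEq G]

/-- The set of differences of distinct elements of `X`. -/
def differences (X : Finset G) : Finset G :=
  X.offDiag.image fun p => p.1 - p.2

lemma mem_differences {X : Finset G} {g : G} :
    g ∈ differences X ↔ ∃ x ∈ X, ∃ y ∈ X, x ≠ y ∧ x - y = g := by
  simp only [differences, mem_image, mem_offDiag, Prod.exists]
  constructor
  · rintro ⟨x, y, ⟨hx, hy, hxy⟩, h⟩
    exact ⟨x, hx, y, hy, hxy, h⟩
  · rintro ⟨x, hx, y, hy, hxy, h⟩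
    exact ⟨x, y, ⟨hx, hy, hxy⟩, h⟩

lemma neg_mem_differences {X : Finset G} {g : G} (hg : g ∈ differences X) :
    -g ∈ differences X := by
  obtain ⟨x, hx, y, hy, hxy, rfl⟩ := mem_differences.1 hg
  exact mem_differences.2 ⟨y, hy, x, hx, hxy.symm, by abel⟩

/-- The weight of an element: that of its class, increased at the involution of class `2` and on
the exceptional set `t`. -/
def weight (φ : G →+ ZMod 4) (t : Finset G) (x : G) : ℕ :=
  if x = 0 then 0 else
    classWeight (φ x) + (if φ x = 2 ∧ x + x = 0 then 3 else 0) + (if x ∈ t then 2 else 0)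

variable {φ : G →+ ZMod 4} {t : Finset G}

lemma classWeight_neg (i : ZMod 4) : classWeight (-i) = classWeight i := by
  revert i; decide

lemma classWeight_le_weight {x : G} (hx : x ≠ 0) : classWeight (φ x) ≤ weight φ t x := by
  simp only [weight, if_neg hx]
  omega

lemma two_mul_classWeight_le_sum_pair (hker : ∀ x, φ x = 0 → x + x = 0 → x = 0)
    {x : G} (hx : x ≠ 0) :
    2 * classWeight (φ x) ≤ ∑ g ∈ {x, -x}, weight φ t g := by
  by_cases h : x = -x
  · have hxx : x + x = 0 := by nth_rewrite 1 [h]; abel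
    have hφ : φ x = 2 := by
      have h1 : φ x + φ x = 0 := by rw [← map_add, hxx, map_zero]
      have h2 : φ x ≠ 0 := fun h0 => hx (hker x h0 hxx)
      have key : ∀ i : ZMod 4, i + i = 0 → i ≠ 0 → i = 2 := by decide
      exact key _ h1 h2
    rw [← h, pair_eq_singleton, sum_singleton]
    simp only [weight, if_neg hx, hφ, hxx, and_self, if_true]
    have : classWeight 2 = 3 := by decide
    omega
  · rw [sum_pair h]
    have h1 := classWeight_le_weight (φ := φ) (t := t) hx
    have h2 := classWeight_le_weight (φ := φ) (t := t) (neg_ne_zero.2 hx)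
    rw [map_neg, classWeight_neg] at h2
    omega

lemma disjoint_neg_pairs {x y : G} (h : x ≠ y) (h' : x ≠ -y) :
    Disjoint ({x, -x} : Finset G) {y, -y} := by
  have h1 : -x ≠ y := fun e => h' (by rw [← e, neg_neg])
  have h2 : -x ≠ -y := fun e => h (neg_injective e)
  simp [h.symm, Ne.symm h', h1.symm, h2.symm]

lemma neg_pair_subset {D : Finset G} (hD : ∀ g ∈ D, -g ∈ D) {x : G} (hx : x ∈ D) :
    ({x, -x} : Finset G) ⊆ D := by
  simp [insert_subset_iff, hx, hD x hx]

lemma eight_le_sum_weight_of_double_mem (hker : ∀ x, φ x = 0 → x + x = 0 → x = 0)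
    {D : Finset G} (hD : ∀ g ∈ D, -g ∈ D) {x : G} (hx : x ∈ D) (hxx : x + x ∈ D)
    (hx0 : x ≠ 0) (hxx0 : x + x ≠ 0) (ht : x + x + x = 0 → x ∈ t ∧ -x ∈ t) :
    8 ≤ ∑ g ∈ D, weight φ t g := by
  by_cases h3 : x + x + x = 0
  · have hφ : φ x = 0 := by
      have h1 : φ x + φ x + φ x = 0 := by rw [← map_add, ← map_add, h3, map_zero]
      have key : ∀ i : ZMod 4, i + i + i = 0 → i = 0 := by decide
      exact key _ h1
    have hne : x ≠ -x := fun h => hxx0 (by nth_rewrite 1 [h]; abel)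
    refine le_trans ?_ (sum_le_sum_of_subset (neg_pair_subset hD hx))
    rw [sum_pair hne]
    obtain ⟨h1, h2⟩ := ht h3
    have : classWeight 0 = 2 := by decide
    simp only [weight, if_neg hx0, if_neg (neg_ne_zero.2 hx0), map_neg, hφ, neg_zero, if_pos h1,
      if_pos h2, this]
    omega
  · have hdis : Disjoint ({x, -x} : Finset G) {x + x, -(x + x)} := by
      refine disjoint_neg_pairs (fun h => hx0 (by simpa using h)) (fun h => h3 ?_)
      nth_rewrite 3 [h]
      abel
    refine le_trans ?_ (sum_le_sum_of_subset
      (union_subset (neg_pair_subset hD hx) (neg_pair_subset hD hxx)))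
    rw [sum_union hdis]
    have h1 := two_mul_classWeight_le_sum_pair (t := t) hker hx0
    have h2 := two_mul_classWeight_le_sum_pair (t := t) hker hxx0
    have key : ∀ i : ZMod 4, 4 ≤ classWeight i + classWeight (i + i) := by decide
    have h3 := key (φ x)
    rw [map_add] at h2
    omega

lemma eight_le_sum_weight_of_add_mem (hker : ∀ x, φ x = 0 → x + x = 0 → x = 0)
    {D : Finset G} (hD : ∀ g ∈ D, -g ∈ D) {x y : G} (hx : x ∈ D) (hy : y ∈ D) (hxy : x + y ∈ D)
    (hx0 : x ≠ 0) (hy0 : y ≠ 0) (hxy0 : x + y ≠ 0) (h1 : x ≠ y) (h2 : x + y ≠ -x)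
    (h3 : x + y ≠ -y) :
    8 ≤ ∑ g ∈ D, weight φ t g := by
  have d1 : Disjoint ({x, -x} : Finset G) {y, -y} :=
    disjoint_neg_pairs h1 fun h => hxy0 (by rw [h]; abel)
  have d2 : Disjoint ({x, -x} ∪ {y, -y} : Finset G) {x + y, -(x + y)} := by
    refine disjoint_union_left.2 ⟨(disjoint_neg_pairs (fun h => hy0 ?_) h2).symm,
      (disjoint_neg_pairs (fun h => hx0 ?_) h3).symm⟩
    · simpa using h
    · simpa using h
  refine le_trans ?_ (sum_le_sum_of_subset (union_subset (union_subset
    (neg_pair_subset hD hx) (neg_pair_subset hD hy)) (neg_pair_subset hD hxy)))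
  rw [sum_union d2, sum_union d1]
  have h1 := two_mul_classWeight_le_sum_pair (t := t) hker hx0
  have h2 := two_mul_classWeight_le_sum_pair (t := t) hker hy0
  have h3 := two_mul_classWeight_le_sum_pair (t := t) hker hxy0
  have key : ∀ i j : ZMod 4, 4 ≤ classWeight i + classWeight j + classWeight (i + j) := by decide
  have h4 := key (φ x) (φ y)
  rw [map_add] at h3
  omega

lemma eight_le_sum_weight_differences (hker : ∀ x, φ x = 0 → x + x = 0 → x = 0)
    {X : Finset G} (hX : X.card = 3)
    (ht : ∀ p ∈ X, ∀ a, a ≠ 0 → a + a + a = 0 → p + a ∈ X → p + a + a ∈ X → a ∈ t ∧ -a ∈ t) :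
    8 ≤ ∑ g ∈ differences X, weight φ t g := by
  obtain ⟨p, q, r, hpq, hpr, hqr, rfl⟩ := card_eq_three.1 hX
  have hD : ∀ g ∈ differences {p, q, r}, -g ∈ differences {p, q, r} :=
    fun g => neg_mem_differences
  have hmem : ∀ a ∈ ({p, q, r} : Finset G), ∀ b ∈ ({p, q, r} : Finset G), a ≠ b →
      a - b ∈ differences {p, q, r} :=
    fun a ha b hb hab => mem_differences.2 ⟨a, ha, b, hb, hab, rfl⟩
  have hp : p ∈ ({p, q, r} : Finset G) := by simp
  have hq : q ∈ ({p, q, r} : Finset G) := by simp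
  have hr : r ∈ ({p, q, r} : Finset G) := by simp
  have progression : ∀ a ∈ ({p, q, r} : Finset G), ∀ b ∈ ({p, q, r} : Finset G),
      ∀ c ∈ ({p, q, r} : Finset G), a ≠ b → a ≠ c → b - a = c - b →
      8 ≤ ∑ g ∈ differences {p, q, r}, weight φ t g := by
    intro a ha b hb c hc hab hac h
    have hca : b - a + (b - a) = c - a := by nth_rewrite 2 [h]; abel
    refine eight_le_sum_weight_of_double_mem hker hD (hmem b hb a ha hab.symm) ?_
      (sub_ne_zero.2 hab.symm) ?_ fun h3 => ht a ha _ (sub_ne_zero.2 hab.symm) h3 ?_ ?_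
    · rw [hca]; exact hmem c hc a ha hac.symm
    · rw [hca]; exact sub_ne_zero.2 hac.symm
    · simpa using hb
    · rw [add_assoc, hca]; simpa using hc
  by_cases h1 : q - p = r - q
  · exact progression p hp q hq r hr hpq hpr h1
  by_cases h2 : r - q = p - r
  · exact progression q hq r hr p hp hqr hpq.symm h2
  by_cases h3 : p - r = q - p
  · exact progression r hr p hp q hq hpr.symm hqr.symm h3
  have hs : q - p + (r - q) = r - p := by abel
  refine eight_le_sum_weight_of_add_mem hker hD (hmem q hq p hp hpq.symm)
    (hmem r hr q hq hqr.symm) (by rw [hs]; exact hmem r hr p hp hpr.symm)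
    (sub_ne_zero.2 hpq.symm) (sub_ne_zero.2 hqr.symm) (by rw [hs]; exact sub_ne_zero.2 hpr.symm)
    h1 ?_ ?_
  · rw [hs]
    intro h
    exact h3 (by rw [← neg_sub r p, h, neg_neg])
  · rw [hs]
    intro h
    exact h2 (by rw [← neg_sub r p, h, neg_neg])

variable [Fintype G]

lemma four_mul_sum_weight_le (hker : ∀ x, φ x = 0 → x + x = 0 → x = 0) {e : G} (he : φ e = 1) :
    4 * ∑ x, weight φ t x ≤ 7 * Fintype.card G + 4 + 8 * t.card := by
  have hpt : ∀ x, weight φ t x + (if x = 0 then 2 else 0) ≤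
      classWeight (φ x) + (if φ x = 2 ∧ x + x = 0 then 3 else 0) + (if x ∈ t then 2 else 0) := by
    intro x
    by_cases hx : x = 0
    · subst hx
      have : classWeight 0 = 2 := by decide
      simp only [weight, if_true, map_zero, this]
      omega
    · simp [weight, hx]
  have hsum := sum_le_sum fun x (_ : x ∈ (univ : Finset G)) => hpt x
  simp only [sum_add_distrib] at hsum
  have h0 : ∑ x : G, (if x = 0 then 2 else 0) = 2 := by simp
  have ht : ∑ x : G, (if x ∈ t then 2 else 0) = 2 * t.card := by simp [mul_comm]
  have hz : ∑ x : G, (if φ x = 2 ∧ x + x = 0 then 3 else 0) ≤ 3 := by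
    have hcard : (univ.filter fun x : G => φ x = 2 ∧ x + x = 0).card ≤ 1 := by
      refine card_le_one.2 fun x hx y hy => ?_
      simp only [mem_filter, mem_univ, true_and] at hx hy
      refine sub_eq_zero.1 (hker _ (by rw [map_sub, hx.1, hy.1, sub_self]) ?_)
      rw [show x - y + (x - y) = x + x - (y + y) by abel, hx.2, hy.2, sub_zero]
    rw [← sum_filter, sum_const, smul_eq_mul]
    omega
  have hc := four_mul_sum_classWeight (φ := φ) he
  omega

theorem card_le_of_disjoint_differences (hker : ∀ x, φ x = 0 → x + x = 0 → x = 0)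
    {e : G} (he : φ e = 1) {F : Finset (Finset G)} (hcard : ∀ X ∈ F, X.card = 3)
    (hdis : ∀ X ∈ F, ∀ Y ∈ F, X ≠ Y → Disjoint (differences X) (differences Y))
    (ht : ∀ X ∈ F, ∀ p ∈ X, ∀ a, a ≠ 0 → a + a + a = 0 → p + a ∈ X → p + a + a ∈ X →
      a ∈ t ∧ -a ∈ t) :
    32 * F.card ≤ 7 * Fintype.card G + 4 + 8 * t.card := by
  have h1 : F.card * 8 ≤ ∑ X ∈ F, ∑ g ∈ differences X, weight φ t g :=
    card_nsmul_le_sum F _ 8 fun X hX => eight_le_sum_weight_differences hker (hcard X hX) (ht X hX)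
  rw [← sum_biUnion fun X hX Y hY hXY => hdis X hX Y hY hXY] at h1
  have h2 := sum_le_sum_of_subset (f := weight φ t)
    (subset_univ (F.biUnion (differences (G := G))))
  have h3 := four_mul_sum_weight_le (t := t) hker he
  omega

end Weighting

lemma ZMod.card_three_torsion_le (m : ℕ) [NeZero m] :
    (univ.filter fun a : ZMod m => a + a + a = 0).card ≤ if 3 ∣ m then 3 else 1 := by
  split_ifs with h
  · have := IsAddCyclic.card_nsmul_eq_zero_le (α := ZMod m) (n := 3) (by norm_num)
    refine le_trans (card_le_card fun a ha => ?_) this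
    simp only [mem_filter, mem_univ, true_and] at ha ⊢
    rw [← ha]; abel
  · refine card_le_one.2 fun a ha b hb => ?_
    have hz : ∀ c : ZMod m, c + c + c = 0 → c = 0 := by
      intro c hc
      have hu : IsUnit ((3 : ℕ) : ZMod m) :=
        (ZMod.isUnit_iff_coprime 3 m).2 ((Nat.Prime.coprime_iff_not_dvd Nat.prime_three).2 h)
      refine (hu.mul_right_eq_zero).1 ?_
      rw [← hc]; push_cast; ring
    simp only [mem_filter, mem_univ, true_and] at ha hb
    rw [hz a ha, hz b hb]

lemma card_nonzero_three_torsion_le (m n : ℕ) [NeZero m] [NeZero n] :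
    (univ.filter fun x : ZMod m × ZMod n => x ≠ 0 ∧ x + x + x = 0).card ≤ 2 * xi m n := by
  have hsub : insert 0 (univ.filter fun x : ZMod m × ZMod n => x ≠ 0 ∧ x + x + x = 0) ⊆
      (univ.filter fun a : ZMod m => a + a + a = 0) ×ˢ
        (univ.filter fun b : ZMod n => b + b + b = 0) := by
    intro x hx
    simp only [mem_insert, mem_filter, mem_univ, true_and] at hx
    simp only [mem_product, mem_filter, mem_univ, true_and]
    rcases hx with rfl | ⟨-, hx⟩
    · simp
    · exact ⟨congrArg Prod.fst hx, congrArg Prod.snd hx⟩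
  have h := card_le_card hsub
  rw [card_insert_of_notMem (by simp), card_product] at h
  have h' := h.trans (Nat.mul_le_mul (ZMod.card_three_torsion_le m) (ZMod.card_three_torsion_le n))
  unfold xi
  simp only [Nat.prime_three.dvd_mul]
  by_cases h3 : 3 ∣ m <;> by_cases h4 : 3 ∣ n <;> simp only [h3, h4, if_true, if_false, and_self,
    and_true, and_false, or_true, or_false, or_self] at h' ⊢ <;> omega

lemma ZMod.eq_zero_of_add_self_of_odd {n : ℕ} (hn : Odd n) {a : ZMod n} (ha : a + a = 0) :
    a = 0 := by
  have hu : IsUnit ((2 : ℕ) : ZMod n) :=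
    (ZMod.isUnit_iff_coprime 2 n).2 (Nat.coprime_two_left.2 hn)
  refine (hu.mul_right_eq_zero).1 ?_
  rw [← ha]; push_cast; ring

lemma ZMod.eq_zero_of_add_self_of_cast_four {m : ℕ} (hm : m % 8 = 4) (h4 : 4 ∣ m) {a : ZMod m}
    (ha : a + a = 0) (hc : ZMod.castHom h4 (ZMod 4) a = 0) : a = 0 := by
  have : NeZero m := ⟨by omega⟩
  rw [← ZMod.natCast_zmod_val a] at ha hc ⊢
  rw [map_natCast, ZMod.natCast_eq_zero_iff] at hc
  rw [← Nat.cast_add, ZMod.natCast_eq_zero_iff] at ha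
  rw [ZMod.natCast_eq_zero_iff]
  obtain ⟨k, hk⟩ := h4
  obtain ⟨j, hj⟩ := hc
  rw [hj, hk] at ha ⊢
  have h2 : k ∣ 2 * j := by
    refine Nat.dvd_of_mul_dvd_mul_left (show 0 < 4 by norm_num) ?_
    convert ha using 1
    ring
  refine Nat.mul_dvd_mul_left 4 (Nat.Coprime.dvd_of_dvd_mul_left ?_ h2)
  exact Nat.coprime_two_right.2 (Nat.odd_iff.2 (by omega))

lemma exists_hom_zmod_four {m n : ℕ} (h8 : m * n % 8 = 4) (hpar : ¬ (2 ∣ m ∧ 2 ∣ n)) :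
    ∃ φ : ZMod m × ZMod n →+ ZMod 4,
      (∀ x, φ x = 0 → x + x = 0 → x = 0) ∧ ∃ e, φ e = 1 := by
  have split : ∀ a b : ℕ, a * b % 8 = 4 → b % 2 = 1 → a % 8 = 4 := by
    intro a b h hb
    have hb' : b % 8 = 1 ∨ b % 8 = 3 ∨ b % 8 = 5 ∨ b % 8 = 7 := by omega
    rw [Nat.mul_mod] at h
    rcases hb' with hb' | hb' | hb' | hb' <;> rw [hb'] at h <;> omega
  by_cases hn : n % 2 = 1
  · have hm := split m n h8 hn
    have h4 : 4 ∣ m := by omega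
    refine ⟨(ZMod.castHom h4 (ZMod 4)).toAddMonoidHom.comp (AddMonoidHom.fst _ _), ?_,
      (1, 0), map_one (ZMod.castHom h4 (ZMod 4))⟩
    intro x hx hxx
    exact Prod.ext (ZMod.eq_zero_of_add_self_of_cast_four hm h4 (congrArg Prod.fst hxx) hx)
      (ZMod.eq_zero_of_add_self_of_odd (Nat.odd_iff.2 hn) (congrArg Prod.snd hxx))
  · have hm : m % 2 = 1 := by omega
    have hn := split n m (by rwa [mul_comm]) hm
    have h4 : 4 ∣ n := by omega
    refine ⟨(ZMod.castHom h4 (ZMod 4)).toAddMonoidHom.comp (AddMonoidHom.snd _ _), ?_,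
      (0, 1), map_one (ZMod.castHom h4 (ZMod 4))⟩
    intro x hx hxx
    exact Prod.ext (ZMod.eq_zero_of_add_self_of_odd (Nat.odd_iff.2 hm) (congrArg Prod.fst hxx))
      (ZMod.eq_zero_of_add_self_of_cast_four hn h4 (congrArg Prod.snd hxx) hx)

lemma OOSPC.disjoint_differences {m n k lamA : ℕ} {F : Finset (Finset (ZMod m × ZMod n))}
    (hF : OOSPC m n k lamA 1 F) {X Y : Finset (ZMod m × ZMod n)} (hX : X ∈ F) (hY : Y ∈ F)
    (hXY : X ≠ Y) : Disjoint (differences X) (differences Y) := by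
  refine disjoint_left.2 fun d hdX hdY => ?_
  obtain ⟨x, hx, x', hx', hne, hd⟩ := mem_differences.1 hdX
  obtain ⟨y, hy, y', hy', -, hd'⟩ := mem_differences.1 hdY
  refine hne (card_le_one.1 (hF.2.2 X hX Y hY hXY (x - y)) x ?_ x' ?_)
  · exact mem_inter.2 ⟨hx, mem_image.2 ⟨y, hy, by abel⟩⟩
  · refine mem_inter.2 ⟨hx', mem_image.2 ⟨y', hy', ?_⟩⟩
    have : x - x' = y - y' := hd.trans hd'.symm
    rw [sub_eq_sub_iff_add_eq_add] at this
    rw [sub_add_eq_add_sub, this, add_comm y x', add_sub_cancel_right]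

lemma OOSPC.three_torsion_progression_false {m n k lamC : ℕ}
    {F : Finset (Finset (ZMod m × ZMod n))} (hF : OOSPC m n k 2 lamC F)
    {X : Finset (ZMod m × ZMod n)} (hX : X ∈ F) {p a : ZMod m × ZMod n} (hp : p ∈ X) (ha : a ≠ 0)
    (h3 : a + a + a = 0) (h1 : p + a ∈ X) (h2 : p + a + a ∈ X) : False := by
  have hcard := hF.2.1 X hX a ha
  have hsub : ({p, p + a, p + a + a} : Finset (ZMod m × ZMod n)) ⊆
      X ∩ X.image (fun x => a + x) := by
    intro x hx
    simp only [mem_insert, mem_singleton] at hx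
    rcases hx with rfl | rfl | rfl
    · exact mem_inter.2 ⟨hp, mem_image.2 ⟨_, h2, by
        rw [show a + (x + a + a) = x + (a + a + a) by abel, h3, add_zero]⟩⟩
    · exact mem_inter.2 ⟨h1, mem_image.2 ⟨_, hp, by abel⟩⟩
    · exact mem_inter.2 ⟨h2, mem_image.2 ⟨_, h1, by abel⟩⟩
  have haa : a + a ≠ 0 := fun h => ha (by simpa [h] using h3)
  have hthree : ({p, p + a, p + a + a} : Finset (ZMod m × ZMod n)).card = 3 :=
    card_eq_three.2 ⟨_, _, _, by simpa using ha, by simpa [add_assoc] using haa,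
      by simpa using ha, rfl⟩
  have := card_le_card hsub
  omega

theorem stmt5 (m n lamA : ℕ) (hm : 0 < m) (hn : 0 < n)
    (h8 : m * n % 8 = 4) (hpar : ¬ (2 ∣ m ∧ 2 ∣ n))
    (hl : lamA = 2 ∨ lamA = 3)
    (F : Finset (Finset (ZMod m × ZMod n))) (hF : OOSPC m n 3 lamA 1 F) :
    F.card ≤ (7 * m * n + 4 + 16 * omega lamA m n) / 32 := by
  have : NeZero m := ⟨hm.ne'⟩
  have : NeZero n := ⟨hn.ne'⟩
  obtain ⟨φ, hker, e, he⟩ := exists_hom_zmod_four h8 hpar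
  have hG : Fintype.card (ZMod m × ZMod n) = m * n := by simp [ZMod.card]
  have hdis : ∀ X ∈ F, ∀ Y ∈ F, X ≠ Y → Disjoint (differences X) (differences Y) :=
    fun X hX Y hY hXY => hF.disjoint_differences hX hY hXY
  rw [Nat.le_div_iff_mul_le (by norm_num), mul_comm, mul_assoc]
  rcases hl with rfl | rfl
  · have h := card_le_of_disjoint_differences (t := ∅) hker he hF.1 hdis
      fun X hX p hp a ha h3 h1 h2 => (hF.three_torsion_progression_false hX hp ha h3 h1 h2).elim
    rw [hG, card_empty] at h
    omega
  · have h := card_le_of_disjoint_differences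
      (t := univ.filter fun x : ZMod m × ZMod n => x ≠ 0 ∧ x + x + x = 0) hker he hF.1 hdis
      fun X hX p hp a ha h3 h1 h2 => by
        have hneg : -a + -a + -a = 0 := by
          rw [show -a + -a + -a = -(a + a + a) by abel, h3, neg_zero]
        simp [ha, h3, hneg]
    have ht := card_nonzero_three_torsion_le m n
    have hω : omega 3 m n = xi m n := by simp [omega]
    rw [hG] at h
    omega
end

section
/- Let m and n be positive integers with mn ≡ 16 (mod 32) such that 4 divides m and 4 divides n, and let λ_a ∈ {2,3}. Then every (m,n,3,λ_a,1)-OOSPC has at most ⌊(13mn+48+32ω)/64⌋ codewords. -/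
open Finset

/-- The weight of a difference `d` in a group of exponent dividing `4 * h`, `h` odd: depending on
the 2-part of `d`, with a bonus for involutions and a bonus `3 * e` for elements of order 3. -/
def diffWeight {G : Type*} [AddCommGroup G] [DecidableEq G] (h : ℕ) (e : ℤ) (d : G) : ℤ :=
  2 + 2 * (if (2 * h) • d = 0 then 1 else 0) - (if h • d = 0 then 1 else 0)
    + 4 * (if 2 • d = 0 then 1 else 0) + 3 * e * (if 3 • d = 0 then 1 else 0)

lemma two_mul_nsmul_eq_zero {G : Type*} [AddCommGroup G] {h : ℕ} {d : G} (hd : h • d = 0) :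
    (2 * h) • d = 0 := by
  rw [mul_nsmul', hd, nsmul_zero]

section Weight

variable {G : Type*} [AddCommGroup G] [DecidableEq G] {h : ℕ} {e : ℤ}

lemma two_le_diffWeight (he : 0 ≤ e) (d : G) : 2 ≤ diffWeight h e d := by
  unfold diffWeight
  have h2 : h • d = 0 → (2 * h) • d = 0 := two_mul_nsmul_eq_zero
  split_ifs <;> simp_all <;> linarith

lemma three_le_diffWeight (he : 0 ≤ e) {d : G} (hd : (2 * h) • d = 0) :
    3 ≤ diffWeight h e d := by
  unfold diffWeight
  split_ifs <;> simp_all <;> linarith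

lemma four_le_diffWeight (he : 0 ≤ e) {d : G} (hd : (2 * h) • d = 0) (hd' : h • d ≠ 0) :
    4 ≤ diffWeight h e d := by
  unfold diffWeight
  split_ifs <;> simp_all; linarith

lemma diffWeight_neg (d : G) : diffWeight h e (-d) = diffWeight h e d := by
  simp [diffWeight]

lemma eight_le_diffWeight (hodd : Odd h) (he : 0 ≤ e) {d : G} (hd : 2 • d = 0) (hd0 : d ≠ 0) :
    8 ≤ diffWeight h e d := by
  obtain ⟨k, rfl⟩ := hodd
  have h1 : (2 * k + 1) • d = d := by
    rw [add_nsmul, one_nsmul, mul_nsmul, hd, nsmul_zero, zero_add]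
  have h2 : (2 * (2 * k + 1)) • d = 0 := by rw [mul_nsmul', h1, hd]
  unfold diffWeight
  rw [h1, h2, hd]
  split_ifs <;> simp_all

lemma six_le_diffWeight (hexp : ∀ d : G, (4 * h) • d = 0) {d : G} (hd : 3 • d = 0) :
    6 ≤ diffWeight h 1 d := by
  have h1 : h • d = 0 := by
    have h2 : (4 * h) • d = h • d + h • (3 • d) := by
      rw [← mul_nsmul', ← add_nsmul]; congr 1; ring
    rwa [hexp, hd, nsmul_zero, add_zero, eq_comm] at h2
  unfold diffWeight
  rw [two_mul_nsmul_eq_zero h1, h1, hd]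
  split_ifs <;> simp_all

lemma twelve_le_sum_of_involution (hodd : Odd h) (he : 0 ≤ e) {S : Finset G} {a b c : G}
    (habc : a + b + c = 0) (ha : a ≠ 0) (hc : c ≠ 0) (hb : b ≠ 0) (ha2 : 2 • a = 0)
    (haS : a ∈ S) (hbS : b ∈ S) (hcS : c ∈ S) (hbS' : -b ∈ S) :
    12 ≤ ∑ d ∈ S, diffWeight h e d := by
  have key : ∀ x y : G, a ≠ x → a ≠ y → x ≠ y → x ∈ S → y ∈ S →
      12 ≤ ∑ d ∈ S, diffWeight h e d := by
    intro x y h1 h2 h3 hx hy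
    have hsub : ({a, x, y} : Finset G) ⊆ S := by
      simp [Finset.insert_subset_iff, *]
    have := Finset.sum_le_sum_of_subset_of_nonneg (f := diffWeight h e) hsub
      (fun i _ _ => by linarith [two_le_diffWeight (h := h) he i])
    rw [Finset.sum_insert (by simp [*]), Finset.sum_insert (by simp [*]),
      Finset.sum_singleton] at this
    linarith [eight_le_diffWeight hodd he ha2 ha, two_le_diffWeight (h := h) he x,
      two_le_diffWeight (h := h) he y]
  have haa : a = -a := by rw [two_nsmul] at ha2; exact eq_neg_of_add_eq_zero_left ha2
  have hab : a ≠ b := by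
    rintro rfl
    rw [two_nsmul] at ha2
    rw [ha2, zero_add] at habc
    exact hc habc
  have hac : a ≠ c := by
    rintro rfl
    have : b + 2 • a = 0 := by rw [← habc, two_nsmul]; abel
    rw [ha2, add_zero] at this
    exact hb this
  by_cases hbc : b = c
  · subst hbc
    refine key b (-b) hab (fun hh => hab ?_) (fun hh => ?_) hbS hbS'
    · rw [haa, hh, neg_neg]
    · have : b + b = 0 := by nth_rw 2 [hh]; simp
      rw [add_assoc, this, add_zero] at habc
      exact ha habc
  · exact key b c hab hac hbc hbS hcS

lemma twelve_le_sum_of_eq (hexp : ∀ d : G, (4 * h) • d = 0) (he : e = 0 ∨ e = 1)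
    {S : Finset G} {a c : G} (habc : a + a + c = 0) (h3 : e = 0 → a ≠ c)
    (ha2 : 2 • a ≠ 0) (hc2 : 2 • c ≠ 0)
    (haS : a ∈ S) (hcS : c ∈ S) (haS' : -a ∈ S) (hcS' : -c ∈ S) :
    12 ≤ ∑ d ∈ S, diffWeight h e d := by
  have he0 : 0 ≤ e := by rcases he with rfl | rfl <;> norm_num
  have ne_neg : ∀ x : G, 2 • x ≠ 0 → x ≠ -x := by
    intro x hx hh
    apply hx
    rw [two_nsmul]
    nth_rw 2 [hh]
    simp
  by_cases hac : a = c
  · subst hac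
    have he1 : e = 1 := he.resolve_left (fun hh => h3 hh rfl)
    subst he1
    have h3a : 3 • a = 0 := by rw [← habc, succ_nsmul, two_nsmul]
    have hsub : ({a, -a} : Finset G) ⊆ S := by simp [Finset.insert_subset_iff, *]
    have := Finset.sum_le_sum_of_subset_of_nonneg (f := diffWeight h 1) hsub
      (fun i _ _ => by linarith [two_le_diffWeight (h := h) he0 i])
    rw [Finset.sum_pair (ne_neg a ha2), diffWeight_neg] at this
    linarith [six_le_diffWeight hexp h3a]
  · have hanc : a ≠ -c := by
      rintro rfl
      apply ha2
      simp at habc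
      simp [habc]
    have hanc' : -a ≠ c := fun hh => hanc (by rw [← hh, neg_neg])
    have hsub : ({a, -a, c, -c} : Finset G) ⊆ S := by simp [Finset.insert_subset_iff, *]
    have := Finset.sum_le_sum_of_subset_of_nonneg (f := diffWeight h e) hsub
      (fun i _ _ => by linarith [two_le_diffWeight (h := h) he0 i])
    rw [Finset.sum_insert (by simp [*]), Finset.sum_insert (by simp [*]),
      Finset.sum_pair (ne_neg c hc2), diffWeight_neg, diffWeight_neg] at this
    have hca : c = -(2 • a) := by
      rw [two_nsmul]; exact eq_neg_of_add_eq_zero_right habc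
    have hc : (2 * h) • c = 0 := by
      rw [hca, smul_neg, ← mul_nsmul', show 2 * h * 2 = 4 * h by ring, hexp, neg_zero]
    by_cases hhc : h • c = 0
    · have hha : (2 * h) • a = 0 := by
        rwa [hca, smul_neg, neg_eq_zero, ← mul_nsmul', mul_comm] at hhc
      linarith [three_le_diffWeight he0 hc, three_le_diffWeight he0 hha]
    · linarith [four_le_diffWeight he0 hc hhc, two_le_diffWeight (h := h) he0 a]

/-- The differences of a triangle with edge vectors `a`, `b`, `c` have total weight at least 12,
unless the triangle is a coset of a subgroup of order 3 and `e = 0`. -/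
lemma twelve_le_sum_diffWeight (hodd : Odd h) (hexp : ∀ d : G, (4 * h) • d = 0)
    (he : e = 0 ∨ e = 1) {S : Finset G} {a b c : G}
    (habc : a + b + c = 0) (ha : a ≠ 0) (hb : b ≠ 0) (hc : c ≠ 0)
    (h3 : e = 0 → ¬ (a = b ∧ b = c))
    (haS : a ∈ S) (hbS : b ∈ S) (hcS : c ∈ S) (haS' : -a ∈ S) (hbS' : -b ∈ S) (hcS' : -c ∈ S) :
    12 ≤ ∑ d ∈ S, diffWeight h e d := by
  have he0 : 0 ≤ e := by rcases he with rfl | rfl <;> norm_num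
  have hbca : b + c + a = 0 := by rw [← habc]; abel
  have hcab : c + a + b = 0 := by rw [← habc]; abel
  by_cases ha2 : 2 • a = 0
  · exact twelve_le_sum_of_involution hodd he0 habc ha hc hb ha2 haS hbS hcS hbS'
  by_cases hb2 : 2 • b = 0
  · exact twelve_le_sum_of_involution hodd he0 hbca hb ha hc hb2 hbS hcS haS hcS'
  by_cases hc2 : 2 • c = 0
  · exact twelve_le_sum_of_involution hodd he0 hcab hc hb ha hc2 hcS haS hbS haS'
  by_cases hab : a = b
  · subst hab
    exact twelve_le_sum_of_eq hexp he habc (fun hh h' => h3 hh ⟨rfl, h'⟩) ha2 hc2 haS hcS haS' hcS'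
  by_cases hbc : b = c
  · subst hbc
    exact twelve_le_sum_of_eq hexp he hbca (fun hh h' => h3 hh ⟨h'.symm, rfl⟩)
      hb2 ha2 hbS haS hbS' haS'
  by_cases hca : c = a
  · subst hca
    exact twelve_le_sum_of_eq hexp he hcab (fun hh h' => h3 hh ⟨h', h'.symm⟩)
      hc2 hb2 hcS hbS hcS' hbS'
  have ne_neg : ∀ x : G, ¬ 2 • x = 0 → x ≠ -x := by
    intro x hx hh
    apply hx
    rw [two_nsmul]
    nth_rw 2 [hh]
    simp
  have ne_neg_of : ∀ x y z : G, x + y + z = 0 → z ≠ 0 → x ≠ -y := by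
    rintro x y z hxyz hz rfl
    simp at hxyz
    exact hz hxyz
  have h1 := ne_neg a ha2
  have h2 := ne_neg b hb2
  have h3 := ne_neg c hc2
  have h4 := ne_neg_of _ _ _ habc hc
  have h5 := ne_neg_of _ _ _ hbca ha
  have h6 := ne_neg_of _ _ _ hcab hb
  have hsub : ({a, -a, b, -b, c, -c} : Finset G) ⊆ S := by simp [Finset.insert_subset_iff, *]
  have hsum := Finset.sum_le_sum_of_subset_of_nonneg (f := diffWeight h e) hsub
    (fun i _ _ => by linarith [two_le_diffWeight (h := h) he0 i])
  have h4' : -a ≠ b := fun hh => h4 (by rw [← hh, neg_neg])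
  have h5' : -b ≠ c := fun hh => h5 (by rw [← hh, neg_neg])
  have h6' : a ≠ -c := fun hh => h6 (by rw [hh, neg_neg])
  have h6'' : -a ≠ c := fun hh => h6 hh.symm
  have hca' : a ≠ c := fun hh => hca hh.symm
  rw [Finset.sum_insert (by simp [*]), Finset.sum_insert (by simp [*]),
    Finset.sum_insert (by simp [*]), Finset.sum_insert (by simp [*]),
    Finset.sum_pair h3, diffWeight_neg, diffWeight_neg, diffWeight_neg] at hsum
  linarith [two_le_diffWeight (h := h) he0 a, two_le_diffWeight (h := h) he0 b,
    two_le_diffWeight (h := h) he0 c]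

end Weight

lemma card_nsmul_eq_zero_zmod_prod (m n c : ℕ) [NeZero m] [NeZero n] :
    #{p : ZMod m × ZMod n | c • p = 0} = m.gcd c * n.gcd c := by
  have key : ∀ k : ℕ, [NeZero k] → #{x : ZMod k | c • x = 0} = k.gcd c := by
    intro k _
    have := IsAddCyclic.card_nsmulAddMonoidHom_ker (G := ZMod k) c
    rw [Nat.card_zmod] at this
    rw [← this, ← Fintype.card_subtype, ← Nat.card_eq_fintype_card]
    rfl
  rw [← key m, ← key n, ← Finset.card_product]
  congr 1
  ext ⟨x, y⟩
  simp [-nsmul_eq_mul, Prod.ext_iff]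

lemma gcd_three_mul_gcd_three (m n : ℕ) : m.gcd 3 * n.gcd 3 = 1 + 2 * xi m n := by
  have key : ∀ k : ℕ, k.gcd 3 = if 3 ∣ k then 3 else 1 := by
    intro k
    split_ifs with hk
    · exact Nat.gcd_eq_right hk
    · exact ((Nat.Prime.coprime_iff_not_dvd Nat.prime_three).2 hk).symm
  rw [key, key, xi]
  by_cases h1 : 3 ∣ m <;> by_cases h2 : 3 ∣ n <;> simp [h1, h2, Nat.prime_three.dvd_mul]

lemma sum_diffWeight {s t : ℕ} (hst : Odd (s * t)) (e : ℤ)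
    [NeZero (4 * s)] [NeZero (4 * t)] :
    ∑ d ∈ univ.erase (0 : ZMod (4 * s) × ZMod (4 * t)), diffWeight (s * t) e d
      = 39 * (s * t) + 9 + 6 * e * xi (4 * s) (4 * t) := by
  obtain ⟨hs, ht⟩ := Nat.odd_mul.1 hst
  have g1 : ∀ k l : ℕ, Odd l → (4 * k).gcd (k * l) = k := fun k l hl => by
    rw [mul_comm 4 k, Nat.gcd_mul_left,
      show Nat.gcd 4 l = 1 from Nat.Coprime.pow_left 2 (Nat.coprime_two_left.2 hl), mul_one]
  have g2 : ∀ k l : ℕ, Odd l → (4 * k).gcd (2 * (k * l)) = 2 * k := fun k l hl => by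
    rw [show 4 * k = 2 * k * 2 by ring, ← mul_assoc, Nat.gcd_mul_left,
      show Nat.gcd 2 l = 1 from Nat.coprime_two_left.2 hl, mul_one]
  have c1 := card_nsmul_eq_zero_zmod_prod (4 * s) (4 * t) (s * t)
  have c2 := card_nsmul_eq_zero_zmod_prod (4 * s) (4 * t) (2 * (s * t))
  have c3 := card_nsmul_eq_zero_zmod_prod (4 * s) (4 * t) 2
  have c4 := card_nsmul_eq_zero_zmod_prod (4 * s) (4 * t) 3
  rw [gcd_three_mul_gcd_three] at c4
  rw [g1 s t ht, mul_comm s t, g1 t s hs, mul_comm t s] at c1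
  rw [g2 s t ht, mul_comm s t, g2 t s hs, mul_comm t s] at c2
  rw [Nat.gcd_eq_right (Dvd.intro (2 * s) (by ring)),
    Nat.gcd_eq_right (Dvd.intro (2 * t) (by ring))] at c3
  have hcard : Fintype.card (ZMod (4 * s) × ZMod (4 * t)) = 16 * (s * t) := by
    rw [Fintype.card_prod, ZMod.card, ZMod.card]; ring
  have hall : ∑ d : ZMod (4 * s) × ZMod (4 * t), diffWeight (s * t) e d
      = 39 * (s * t) + 16 + 3 * e * (1 + 2 * xi (4 * s) (4 * t)) := by
    simp only [diffWeight, Finset.sum_add_distrib, Finset.sum_sub_distrib, ← Finset.mul_sum,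
      Finset.sum_boole, c1, c2, c3, c4, Finset.sum_const, Finset.card_univ, hcard]
    push_cast
    simp only [nsmul_eq_mul]
    push_cast
    ring
  have h0 : diffWeight (s * t) e (0 : ZMod (4 * s) × ZMod (4 * t)) = 7 + 3 * e := by
    simp [diffWeight]
  rw [Finset.sum_erase_eq_sub (mem_univ _), hall, h0]
  ring

/-- The set of nonzero differences of a subset of an additive group. -/
def nonzeroDiffs {G : Type*} [AddCommGroup G] [DecidableEq G] (X : Finset G) : Finset G :=
  X.offDiag.image (fun p => p.1 - p.2)

lemma sub_mem_nonzeroDiffs {G : Type*} [AddCommGroup G] [DecidableEq G] {X : Finset G} {x y : G}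
    (hx : x ∈ X) (hy : y ∈ X) (hxy : x ≠ y) : x - y ∈ nonzeroDiffs X :=
  Finset.mem_image.2 ⟨(x, y), Finset.mem_offDiag.2 ⟨hx, hy, hxy⟩, rfl⟩

lemma disjoint_nonzeroDiffs {G : Type*} [AddCommGroup G] [DecidableEq G] {X Y : Finset G}
    (hXY : ∀ g : G, (X ∩ Y.image (fun x => g + x)).card ≤ 1) :
    Disjoint (nonzeroDiffs X) (nonzeroDiffs Y) := by
  rw [Finset.disjoint_left]
  intro d hdX hdY
  obtain ⟨⟨x, x'⟩, hx, rfl⟩ := Finset.mem_image.1 hdX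
  obtain ⟨⟨y, y'⟩, hy, hxy⟩ := Finset.mem_image.1 hdY
  rw [Finset.mem_offDiag] at hx hy
  dsimp only at hx hy hxy
  refine hx.2.2 (Finset.card_le_one.1 (hXY (x - y)) x ?_ x' ?_)
  · exact Finset.mem_inter.2 ⟨hx.1, Finset.mem_image.2 ⟨y, hy.1, by simp⟩⟩
  · refine Finset.mem_inter.2 ⟨hx.2.1, Finset.mem_image.2 ⟨y', hy.2.1, ?_⟩⟩
    have : x = y - y' + x' := by rw [hxy]; simp
    rw [this]
    abel

lemma twelve_le_sum_nonzeroDiffs {G : Type*} [AddCommGroup G] [DecidableEq G] {h : ℕ} {e : ℤ}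
    (hodd : Odd h) (hexp : ∀ d : G, (4 * h) • d = 0) (he : e = 0 ∨ e = 1) {X : Finset G}
    (hX : X.card = 3)
    (hauto : e = 0 → ∀ g : G, g ≠ 0 → (X ∩ X.image (fun x => g + x)).card ≤ 2) :
    12 ≤ ∑ d ∈ nonzeroDiffs X, diffWeight h e d := by
  obtain ⟨x, y, z, hxy, hxz, hyz, rfl⟩ := Finset.card_eq_three.1 hX
  have mem : ∀ u ∈ ({x, y, z} : Finset G), ∀ v ∈ ({x, y, z} : Finset G), u ≠ v →
      u - v ∈ nonzeroDiffs {x, y, z} := fun u hu v hv => sub_mem_nonzeroDiffs hu hv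
  refine twelve_le_sum_diffWeight (a := y - x) (b := z - y) (c := x - z) hodd hexp he (by abel)
    (sub_ne_zero.2 hxy.symm) (sub_ne_zero.2 hyz.symm) (sub_ne_zero.2 hxz) ?_
    (mem y (by simp) x (by simp) hxy.symm) (mem z (by simp) y (by simp) hyz.symm)
    (mem x (by simp) z (by simp) hxz) ?_ ?_ ?_
  · rintro h0 ⟨h1, h2⟩
    have hle := hauto h0 (y - x) (sub_ne_zero.2 hxy.symm)
    have himg : ({x, y, z} : Finset G).image (fun u => y - x + u) = {y, z, x} := by
      have hz : y - x + y = z := by rw [h1]; simp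
      have hx : y - x + z = x := by rw [h1, h2]; simp
      simp [Finset.image_insert, hz, hx]
    have hrot : ({y, z, x} : Finset G) = {x, y, z} := by
      ext u; simp only [Finset.mem_insert, Finset.mem_singleton]; tauto
    rw [himg, hrot, Finset.inter_self, hX] at hle
    omega
  · rw [neg_sub]; exact mem x (by simp) y (by simp) hxy
  · rw [neg_sub]; exact mem y (by simp) z (by simp) hyz
  · rw [neg_sub]; exact mem z (by simp) x (by simp) hxz.symm

theorem stmt8 (m n lamA : ℕ) (hm : 0 < m) (hn : 0 < n)
    (h32 : m * n % 32 = 16) (hm4 : 4 ∣ m) (hn4 : 4 ∣ n)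
    (hl : lamA = 2 ∨ lamA = 3)
    (F : Finset (Finset (ZMod m × ZMod n))) (hF : OOSPC m n 3 lamA 1 F) :
    F.card ≤ (13 * m * n + 48 + 32 * omega lamA m n) / 64 := by
  obtain ⟨s, rfl⟩ := hm4
  obtain ⟨t, rfl⟩ := hn4
  have : NeZero (4 * s) := ⟨hm.ne'⟩
  have : NeZero (4 * t) := ⟨hn.ne'⟩
  obtain ⟨hcard, hauto, hcross⟩ := hF
  have hst : 4 * s * (4 * t) = 16 * (s * t) := by ring
  have hodd : Odd (s * t) := by rw [Nat.odd_iff]; omega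
  have hexp : ∀ d : ZMod (4 * s) × ZMod (4 * t), (4 * (s * t)) • d = 0 := by
    rintro ⟨x, y⟩
    ext
    · simp only [Prod.smul_fst, Prod.fst_zero]
      rw [show 4 * (s * t) = t * (4 * s) by ring, mul_nsmul', nsmul_eq_mul (4 * s), ZMod.natCast_self]
      simp
    · simp only [Prod.smul_snd, Prod.snd_zero]
      rw [show 4 * (s * t) = s * (4 * t) by ring, mul_nsmul', nsmul_eq_mul (4 * t), ZMod.natCast_self]
      simp
  have main : ∀ e : ℤ, e = 0 ∨ e = 1 → (e = 0 → lamA = 2) →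
      12 * (F.card : ℤ) ≤ 39 * (s * t) + 9 + 6 * e * xi (4 * s) (4 * t) := by
    intro e he hlam
    have he0 : 0 ≤ e := by rcases he with rfl | rfl <;> norm_num
    calc 12 * (F.card : ℤ) = ∑ X ∈ F, (12 : ℤ) := by simp [mul_comm]
      _ ≤ ∑ X ∈ F, ∑ d ∈ nonzeroDiffs X, diffWeight (s * t) e d :=
        Finset.sum_le_sum fun X hX => twelve_le_sum_nonzeroDiffs hodd hexp he (hcard X hX)
          fun h0 => hlam h0 ▸ hauto X hX
      _ = ∑ d ∈ F.biUnion nonzeroDiffs, diffWeight (s * t) e d :=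
        (Finset.sum_biUnion fun X hX Y hY hXY =>
          disjoint_nonzeroDiffs (hcross X hX Y hY hXY)).symm
      _ ≤ ∑ d ∈ univ.erase (0 : ZMod (4 * s) × ZMod (4 * t)),
           diffWeight (s * t) e d := by
        refine Finset.sum_le_sum_of_subset_of_nonneg ?_
          fun d _ _ => by linarith [two_le_diffWeight (h := s * t) he0 d]
        intro d hd
        simp only [Finset.mem_biUnion, nonzeroDiffs, Finset.mem_image, Finset.mem_offDiag] at hd
        obtain ⟨X, -, p, hp, rfl⟩ := hd
        exact Finset.mem_erase.2 ⟨sub_ne_zero.2 hp.2.2, mem_univ _⟩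
      _ = _ := sum_diffWeight hodd e
  rw [Nat.le_div_iff_mul_le (by norm_num), mul_assoc 13, hst]
  rcases hl with rfl | rfl
  · have := main 0 (Or.inl rfl) fun _ => rfl
    rw [← Nat.cast_mul] at this
    simp only [omega, if_true]
    omega
  · have := main 1 (Or.inr rfl) fun hh => absurd hh one_ne_zero
    rw [← Nat.cast_mul] at this
    simp only [omega, show ¬ (3 = 2) by norm_num, if_false]
    omega
end

section
/- Let m and n be positive integers with m ≡ 8 (mod 16) and n ≡ 4 (mod 8). Then every (m,n,3,2,1)-OOSPC has at most (13mn−32)/64 codewords. -/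
open Finset

section differences

variable {G : Type*} [AddCommGroup G] [DecidableEq G]

/-- The differences occurring in the triple `{0, a, a + b}`. -/
def tripleDiff (a b : G) : Finset G := {a, b, a + b, -a, -b, -(a + b)}

theorem mem_tripleDiff {a b g : G} : g ∈ tripleDiff a b ↔
    g = a ∨ g = b ∨ g = a + b ∨ g = -a ∨ g = -b ∨ g = -(a + b) := by
  simp [tripleDiff]

theorem tripleDiff_comm (a b : G) : tripleDiff a b = tripleDiff b a := by
  ext g
  simp only [mem_tripleDiff, add_comm b a]
  tauto

theorem tripleDiff_add_neg (a b : G) : tripleDiff (a + b) (-b) = tripleDiff a b := by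
  ext g
  simp only [mem_tripleDiff, add_neg_cancel_right, neg_neg]
  tauto

theorem tripleDiff_eq_self_right {a b : G} (h : a + b + b = 0) :
    tripleDiff a b = tripleDiff b b := by
  have h1 : a = -(b + b) := eq_neg_of_add_eq_zero_left (by rwa [← add_assoc])
  have h2 : a + b = -b := eq_neg_of_add_eq_zero_left h
  ext g
  simp only [mem_tripleDiff, h2]
  simp only [h1, neg_neg]
  tauto

theorem tripleDiff_eq_self_left {a b : G} (h : a + a + b = 0) :
    tripleDiff a b = tripleDiff a a := by
  rw [tripleDiff_comm, tripleDiff_eq_self_right (by rw [← h]; abel)]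

variable {W : G → ℕ} (hW : ∀ g, W (-g) = W g) {a b : G}

include hW

theorem sum_tripleDiff_of_generic (ha : a ≠ 0) (hb : b ≠ 0) (hab : a + b ≠ 0)
    (ha2 : a + a ≠ 0) (hb2 : b + b ≠ 0) (hab2 : (a + b) + (a + b) ≠ 0)
    (h1 : a ≠ b) (h2 : a + b + b ≠ 0) (h3 : a + a + b ≠ 0) :
    ∑ g ∈ tripleDiff a b, W g = 2 * (W a + W b + W (a + b)) := by
  unfold tripleDiff
  rw [sum_insert, sum_insert, sum_insert, sum_insert, sum_insert, sum_singleton, hW, hW, hW]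
  · ring
  all_goals simp only [mem_insert, mem_singleton, eq_neg_iff_add_eq_zero]; grind

theorem sum_tripleDiff_self (ha : a ≠ 0) (ha2 : a + a ≠ 0) (ha3 : a + a + a ≠ 0)
    (ha4 : (a + a) + (a + a) ≠ 0) :
    ∑ g ∈ tripleDiff a a, W g = 2 * (W a + W (a + a)) := by
  have : tripleDiff a a = {a, a + a, -a, -(a + a)} := by
    ext g; simp only [mem_tripleDiff, mem_insert, mem_singleton]; tauto
  rw [this, sum_insert, sum_insert, sum_insert, sum_singleton, hW, hW]
  · ring
  all_goals simp only [mem_insert, mem_singleton, eq_neg_iff_add_eq_zero]; grind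

theorem sum_tripleDiff_self_of_four (ha2 : a + a ≠ 0) (ha4 : (a + a) + (a + a) = 0) :
    ∑ g ∈ tripleDiff a a, W g = W (a + a) + 2 * W a := by
  have : tripleDiff a a = {a, a + a, -a} := by
    ext g; simp only [mem_tripleDiff, mem_insert, mem_singleton, neg_eq_of_add_eq_zero_left ha4]
    tauto
  rw [this, sum_insert, sum_insert, sum_singleton, hW]
  · ring
  all_goals simp only [mem_insert, mem_singleton, eq_neg_iff_add_eq_zero]; grind

theorem sum_tripleDiff_of_involution (ha : a ≠ 0) (ha2 : a + a = 0) (hb2 : b + b ≠ 0)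
    (h : a + b + b ≠ 0) :
    ∑ g ∈ tripleDiff a b, W g = W a + 2 * (W b + W (a + b)) := by
  have : tripleDiff a b = {a, b, a + b, -b, -(a + b)} := by
    ext g; simp only [mem_tripleDiff, mem_insert, mem_singleton, neg_eq_of_add_eq_zero_left ha2]
    tauto
  rw [this, sum_insert, sum_insert, sum_insert, sum_insert, sum_singleton, hW, hW]
  · ring
  all_goals
    simp only [mem_insert, mem_singleton, neg_inj, right_eq_add, left_eq_add]
    try simp only [eq_neg_iff_add_eq_zero]
    grind

omit hW in
theorem sum_tripleDiff_of_involutions (ha : a ≠ 0) (hb : b ≠ 0) (hab : a ≠ b) (ha2 : a + a = 0)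
    (hb2 : b + b = 0) :
    ∑ g ∈ tripleDiff a b, W g = W a + W b + W (a + b) := by
  have : tripleDiff a b = {a, b, a + b} := by
    ext g; simp only [mem_tripleDiff, mem_insert, mem_singleton, neg_add,
      neg_eq_of_add_eq_zero_left ha2, neg_eq_of_add_eq_zero_left hb2]
    tauto
  rw [this, sum_insert, sum_insert, sum_singleton]
  · ring
  all_goals simp only [mem_insert, mem_singleton]; grind

end differences

/-- Weights `w` on the residues of `Z_8 × Z_4`, with an additional weight `β` for involutions,
that give every admissible triple a total of at least `20`. Here `good` restricts the triple
having the involution `(4, 0)` as a difference. -/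
structure IsWeighting (w β : ZMod 8 × ZMod 4 → ℕ) (good : ZMod 8 × ZMod 4 → Prop) : Prop where
  zero : w 0 = 5
  bonus_zero : β 0 = 0
  sum_eq : ∑ r, w r = 130
  sum_bonus_le : ∑ r, β r ≤ 14
  neg : ∀ r, w (-r) = w r
  bonus_neg : ∀ r, β (-r) = β r
  good_neg : ∀ r, good (-r) → good r
  generic : ∀ r s, 10 ≤ w r + w s + w (r + s)
  double : ∀ r, 10 ≤ w r + w (r + r)
  involution : ∀ r s, r ≠ 0 → r + r = 0 → (r = (4, 0) → good s ∨ good (r + s)) →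
    20 ≤ w r + β r + 2 * (w s + w (r + s))
  four : ∀ r, r + r ≠ 0 → (r + r) + (r + r) = 0 → (r + r = (4, 0) → good r) →
    20 ≤ w (r + r) + β (r + r) + 2 * w r
  involutions : ∀ r s, r ≠ 0 → s ≠ 0 → r ≠ s → r + r = 0 → s + s = 0 →
    20 ≤ (w r + β r) + (w s + β s) + (w (r + s) + β (r + s))

/-- The weight of a residue, depending on the weights `p`, `q`, `t` of the three nontrivial
classes modulo doubles. -/
def residueWeight (p q t : ℕ) (r : ZMod 8 × ZMod 4) : ℕ :=
  if r.1.val % 2 = 1 then (if r.2.val % 2 = 0 then p else q)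
  else if r.2.val % 2 = 1 then t
  else if r.1.val % 4 = 2 then (if r.2.val = 0 then 10 - p else 10 - q)
  else if r.2.val = 2 then 10 - t else 5

/-- The additional weight `x` for the involution `(4, 0)` and `y` for the other two. -/
def involutionBonus (x y : ℕ) (r : ZMod 8 × ZMod 4) : ℕ :=
  if r = (4, 0) then x else if r = (0, 2) ∨ r = (4, 2) then y else 0

theorem isWeighting_oddEven : IsWeighting (residueWeight 4 3 3) (involutionBonus 0 7)
    (fun r => r.1.val % 2 = 1 ∧ r.2.val % 2 = 0) := by
  constructor <;> decide +kernel

theorem isWeighting_oddOdd : IsWeighting (residueWeight 3 4 3) (involutionBonus 0 7)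
    (fun r => r.1.val % 2 = 1 ∧ r.2.val % 2 = 1) := by
  constructor <;> decide +kernel

theorem isWeighting_even : IsWeighting (residueWeight 3 3 4) (involutionBonus 1 6)
    (fun r => r.1.val % 2 = 0) := by
  constructor <;> decide +kernel

theorem exists_isWeighting (r : ZMod 8 × ZMod 4) :
    ∃ w β good, IsWeighting w β good ∧ good r := by
  rcases Nat.mod_two_eq_zero_or_one r.1.val with h | h
  · exact ⟨_, _, _, isWeighting_even, h⟩
  rcases Nat.mod_two_eq_zero_or_one r.2.val with h' | h'
  · exact ⟨_, _, _, isWeighting_oddEven, h, h'⟩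
  · exact ⟨_, _, _, isWeighting_oddOdd, h, h'⟩

section weighting

variable {H : Type*} [AddCommGroup H] [DecidableEq H]

/-- The weight of an element of `Z_8 × Z_4 × H`, the bonus being given where the `H`-component
vanishes. -/
def totalWeight (w β : ZMod 8 × ZMod 4 → ℕ) (g : (ZMod 8 × ZMod 4) × H) : ℕ :=
  w g.1 + if g.2 = 0 then β g.1 else 0

variable {w β : ZMod 8 × ZMod 4 → ℕ} {good : ZMod 8 × ZMod 4 → Prop}

theorem le_totalWeight (g : (ZMod 8 × ZMod 4) × H) : w g.1 ≤ totalWeight w β g :=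
  Nat.le_add_right _ _

theorem totalWeight_neg (hw : IsWeighting w β good) (g : (ZMod 8 × ZMod 4) × H) :
    totalWeight w β (-g) = totalWeight w β g := by
  simp [totalWeight, hw.neg, hw.bonus_neg]

theorem sum_erase_totalWeight_le [Fintype H] (hw : IsWeighting w β good) :
    ∑ g ∈ univ.erase (0 : (ZMod 8 × ZMod 4) × H), totalWeight w β g
      ≤ 130 * Fintype.card H + 9 := by
  have h0 : totalWeight w β (0 : (ZMod 8 × ZMod 4) × H) = 5 := by
    simp [totalWeight, hw.zero, hw.bonus_zero]
  have hs : ∑ g : (ZMod 8 × ZMod 4) × H, totalWeight w β g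
      = 130 * Fintype.card H + ∑ r, β r := by
    rw [Fintype.sum_prod_type]
    simp only [totalWeight, sum_add_distrib, sum_ite_eq', mem_univ, if_true, sum_const, card_univ,
      smul_eq_mul, ← mul_sum, hw.sum_eq]
    ring
  have := add_sum_erase univ (totalWeight w β) (mem_univ (0 : (ZMod 8 × ZMod 4) × H))
  have := hw.sum_bonus_le
  omega

/-- The condition on a triple to be treated by a weighting with predicate `good`. -/
def Admissible (good : ZMod 8 × ZMod 4 → Prop) (D : Finset ((ZMod 8 × ZMod 4) × H)) : Prop :=
  ((4, 0), 0) ∈ D → ∃ g ∈ D, g ≠ ((4, 0), 0) ∧ good g.1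

variable (hw : IsWeighting w β good) (hH : ∀ t : H, t + t = 0 → t = 0)
  {a b : (ZMod 8 × ZMod 4) × H}

include hw hH

theorem le_sum_tripleDiff_self_of_four (ha2 : a + a ≠ 0) (ha4 : (a + a) + (a + a) = 0)
    (hD : Admissible good (tripleDiff a a)) :
    20 ≤ ∑ g ∈ tripleDiff a a, totalWeight w β g := by
  rw [sum_tripleDiff_self_of_four (totalWeight_neg hw) ha2 ha4]
  obtain ⟨r, t⟩ := a
  obtain rfl : t = 0 := hH _ (hH _ (Prod.ext_iff.1 ha4).2)
  have key := hw.four r (fun h => ha2 (by simp [h])) (Prod.ext_iff.1 ha4).1 ?_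
  · simp [totalWeight]; omega
  intro hr
  obtain ⟨g, hg, hne, hgood⟩ := hD (by simp [mem_tripleDiff, ← hr])
  rw [mem_tripleDiff] at hg
  rcases hg with rfl | rfl | rfl | rfl | rfl | rfl
  · exact hgood
  · exact hgood
  · simp [hr] at hne
  · exact hw.good_neg _ hgood
  · exact hw.good_neg _ hgood
  · rw [neg_eq_of_add_eq_zero_left ha4] at hne
    simp [hr] at hne

theorem le_sum_tripleDiff_of_involution (ha : a ≠ 0) (hb : b ≠ 0) (hab : a + b ≠ 0)
    (ha2 : a + a = 0) (hD : Admissible good (tripleDiff a b)) :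
    20 ≤ ∑ g ∈ tripleDiff a b, totalWeight w β g := by
  by_cases h : a + b + b = 0
  · have hbb : a = b + b := add_left_cancel (a := a) (by rw [ha2, ← add_assoc, h])
    rw [tripleDiff_eq_self_right h] at hD ⊢
    exact le_sum_tripleDiff_self_of_four hw hH (hbb ▸ ha) (hbb ▸ ha2) hD
  by_cases hb2 : b + b = 0
  · have hne : a ≠ b := by
      rintro rfl
      exact hab ha2
    rw [sum_tripleDiff_of_involutions ha hb hne ha2 hb2]
    obtain ⟨r, t⟩ := a
    obtain ⟨s, u⟩ := b
    obtain rfl : t = 0 := hH _ (Prod.ext_iff.1 ha2).2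
    obtain rfl : u = 0 := hH _ (Prod.ext_iff.1 hb2).2
    simpa [totalWeight] using hw.involutions r s (fun h => ha (by simp [h]))
      (fun h => hb (by simp [h])) (fun h => hne (by simp [h]))
      (Prod.ext_iff.1 ha2).1 (Prod.ext_iff.1 hb2).1
  rw [sum_tripleDiff_of_involution (totalWeight_neg hw) ha ha2 hb2 h]
  have hneg : -a = a := neg_eq_of_add_eq_zero_left ha2
  obtain ⟨r, t⟩ := a
  obtain rfl : t = 0 := hH _ (Prod.ext_iff.1 ha2).2
  have key := hw.involution r b.1 (fun h => ha (by simp [h])) (Prod.ext_iff.1 ha2).1 ?_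
  · have h1 := le_totalWeight (w := w) (β := β) b
    have h2 : w (r + b.1) ≤ totalWeight w β ((r, 0) + b) := le_totalWeight ((r, 0) + b)
    have h3 : totalWeight w β (r, (0 : H)) = w r + β r := by simp [totalWeight]
    omega
  rintro rfl
  obtain ⟨g, hg, hne, hgood⟩ := hD (by simp [mem_tripleDiff])
  rw [mem_tripleDiff, hneg] at hg
  rcases hg with rfl | rfl | rfl | rfl | rfl | rfl
  · exact (hne rfl).elim
  · exact .inl hgood
  · exact .inr hgood
  · exact (hne rfl).elim
  · exact .inl (hw.good_neg _ hgood)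
  · exact .inr (hw.good_neg _ hgood)

theorem le_sum_tripleDiff_self (ha : a ≠ 0) (ha2 : a + a ≠ 0) (ha3 : a + a + a ≠ 0)
    (hD : Admissible good (tripleDiff a a)) :
    20 ≤ ∑ g ∈ tripleDiff a a, totalWeight w β g := by
  by_cases ha4 : (a + a) + (a + a) = 0
  · exact le_sum_tripleDiff_self_of_four hw hH ha2 ha4 hD
  rw [sum_tripleDiff_self (totalWeight_neg hw) ha ha2 ha3 ha4]
  have h1 := le_totalWeight (w := w) (β := β) a
  have h2 : w (a.1 + a.1) ≤ totalWeight w β (a + a) := le_totalWeight (a + a)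
  have := hw.double a.1
  omega

theorem le_sum_tripleDiff (ha : a ≠ 0) (hb : b ≠ 0) (hab : a + b ≠ 0)
    (h3 : a = b → a + a + a ≠ 0) (hD : Admissible good (tripleDiff a b)) :
    20 ≤ ∑ g ∈ tripleDiff a b, totalWeight w β g := by
  by_cases ha2 : a + a = 0
  · exact le_sum_tripleDiff_of_involution hw hH ha hb hab ha2 hD
  by_cases hb2 : b + b = 0
  · rw [tripleDiff_comm] at hD ⊢
    exact le_sum_tripleDiff_of_involution hw hH hb ha (by rwa [add_comm]) hb2 hD
  by_cases hab2 : (a + b) + (a + b) = 0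
  · rw [← tripleDiff_add_neg] at hD ⊢
    exact le_sum_tripleDiff_of_involution hw hH hab (by simpa) (by simpa) hab2 hD
  by_cases h1 : a = b
  · subst h1
    exact le_sum_tripleDiff_self hw hH ha ha2 (h3 rfl) hD
  by_cases h4 : a + b + b = 0
  · rw [tripleDiff_eq_self_right h4] at hD ⊢
    exact le_sum_tripleDiff_self hw hH hb hb2
      (fun h => h1 (add_right_cancel (add_right_cancel (h4.trans h.symm)))) hD
  by_cases h5 : a + a + b = 0
  · rw [tripleDiff_eq_self_left h5] at hD ⊢
    exact le_sum_tripleDiff_self hw hH ha ha2 (fun h => h1 (add_left_cancel (h.trans h5.symm))) hD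
  rw [sum_tripleDiff_of_generic (totalWeight_neg hw) ha hb hab ha2 hb2 hab2 h1 h4 h5]
  have e1 := le_totalWeight (w := w) (β := β) a
  have e2 := le_totalWeight (w := w) (β := β) b
  have e3 : w (a.1 + b.1) ≤ totalWeight w β (a + b) := le_totalWeight (a + b)
  have := hw.generic a.1 b.1
  omega

omit hw in
/-- A family of triples with nonzero, pairwise disjoint sets of differences, none of them a coset
of a subgroup of order `3`, has at most `13 |H| / 2` members. -/
theorem two_mul_card_le_of_disjoint_tripleDiff [Fintype H] {ι : Type*} (F : Finset ι)
    (a b : ι → (ZMod 8 × ZMod 4) × H)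
    (ha : ∀ i ∈ F, a i ≠ 0) (hb : ∀ i ∈ F, b i ≠ 0) (hab : ∀ i ∈ F, a i + b i ≠ 0)
    (h3 : ∀ i ∈ F, a i = b i → a i + a i + a i ≠ 0)
    (hdisj : (F : Set ι).PairwiseDisjoint fun i => tripleDiff (a i) (b i)) :
    2 * #F ≤ 13 * Fintype.card H := by
  obtain ⟨w, β, good, hw, hadm⟩ : ∃ w β good, IsWeighting w β good ∧
      ∀ i ∈ F, Admissible good (tripleDiff (a i) (b i)) := by
    by_cases h : ∃ i ∈ F, ((4, 0), 0) ∈ tripleDiff (a i) (b i)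
    · obtain ⟨i, hi, hmem⟩ := h
      obtain ⟨g, hg, hne⟩ : ∃ g ∈ tripleDiff (a i) (b i), g ≠ ((4, 0), 0) := by
        by_cases h0 : a i = ((4, 0), 0)
        · refine ⟨b i, by simp [mem_tripleDiff], fun h1 => hab i hi ?_⟩
          rw [h0, h1]
          ext1
          · exact (by decide : ((4, 0) : ZMod 8 × ZMod 4) + (4, 0) = 0)
          · simp
        · exact ⟨a i, by simp [mem_tripleDiff], h0⟩
      obtain ⟨w, β, good, hw, hgood⟩ := exists_isWeighting g.1
      refine ⟨w, β, good, hw, fun j hj hmem' => ?_⟩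
      obtain rfl : i = j := by
        by_contra hij
        exact disjoint_left.1 (hdisj hi hj hij) hmem hmem'
      exact ⟨g, hg, hne, hgood⟩
    · obtain ⟨w, β, good, hw, -⟩ := exists_isWeighting 0
      exact ⟨w, β, good, hw, fun i hi hmem => (h ⟨i, hi, hmem⟩).elim⟩
  have hsub : F.biUnion (fun i => tripleDiff (a i) (b i)) ⊆ univ.erase 0 := by
    intro g hg
    obtain ⟨i, hi, hg⟩ := mem_biUnion.1 hg
    refine mem_erase.2 ⟨?_, mem_univ _⟩
    rintro rfl
    have := ha i hi
    have := hb i hi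
    have := hab i hi
    rw [mem_tripleDiff] at hg
    simp only [eq_comm (a := (0 : (ZMod 8 × ZMod 4) × H)), neg_eq_zero] at hg
    tauto
  have h1 : #F * 20 ≤ ∑ i ∈ F, ∑ g ∈ tripleDiff (a i) (b i), totalWeight w β g := by
    rw [← smul_eq_mul]
    exact card_nsmul_le_sum _ _ _ fun i hi =>
      le_sum_tripleDiff hw hH (ha i hi) (hb i hi) (hab i hi) (h3 i hi) (hadm i hi)
  rw [← sum_biUnion hdisj] at h1
  have h2 := sum_le_sum_of_subset (f := totalWeight w β) hsub
  have h3 := sum_erase_totalWeight_le (H := H) hw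
  omega

end weighting

theorem ZMod.eq_zero_of_add_self_eq_zero_of_odd {k : ℕ} (hk : Odd k) (x : ZMod k)
    (h : x + x = 0) : x = 0 := by
  have h2 : IsUnit ((2 : ℕ) : ZMod k) :=
    (ZMod.isUnit_iff_coprime 2 k).2 (Nat.coprime_two_left.2 hk)
  rw [← two_mul] at h
  exact (IsUnit.mul_right_eq_zero (by exact_mod_cast h2)).1 h

namespace OOSPC

variable {m n : ℕ} {F : Finset (Finset (ZMod m × ZMod n))}

/-- Distinct codewords have no common difference when the cross-correlation is at most `1`. -/
theorem sub_ne_sub {k l : ℕ} (hF : OOSPC m n k l 1 F) {X Y : Finset (ZMod m × ZMod n)} (hX : X ∈ F)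
    (hY : Y ∈ F) (hXY : X ≠ Y) {x x' y y' : ZMod m × ZMod n} (hx : x ∈ X) (hx' : x' ∈ X)
    (hy : y ∈ Y) (hy' : y' ∈ Y) (hne : x ≠ x') : x - x' ≠ y - y' := by
  intro h
  refine (hF.2.2 X hX Y hY hXY (x - y)).not_gt (one_lt_card.2 ⟨x, ?_, x', ?_, hne⟩)
  · exact mem_inter.2 ⟨hx, mem_image.2 ⟨y, hy, by abel⟩⟩
  · refine mem_inter.2 ⟨hx', mem_image.2 ⟨y', hy', ?_⟩⟩
    calc x - y + y' = x - (y - y') := by abel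
      _ = x' := by rw [← h]; abel

end OOSPC

theorem stmt9 (m n : ℕ) (hm : 0 < m) (hn : 0 < n)
    (hm16 : m % 16 = 8) (hn8 : n % 8 = 4)
    (F : Finset (Finset (ZMod m × ZMod n))) (hF : OOSPC m n 3 2 1 F) :
    F.card ≤ (13 * m * n - 32) / 64 := by
  obtain ⟨p, rfl⟩ : 8 ∣ m := by omega
  obtain ⟨q, rfl⟩ : 4 ∣ n := by omega
  have hp : Odd p := Nat.odd_iff.2 (by omega)
  have hq : Odd q := Nat.odd_iff.2 (by omega)
  have : NeZero p := ⟨by omega⟩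
  have : NeZero q := ⟨by omega⟩
  have h8 : Nat.Coprime 8 p := Nat.Coprime.pow_left 3 (Nat.coprime_two_left.2 hp)
  have h4 : Nat.Coprime 4 q := Nat.Coprime.pow_left 2 (Nat.coprime_two_left.2 hq)
  let e : ZMod (8 * p) × ZMod (4 * q) ≃+ (ZMod 8 × ZMod 4) × (ZMod p × ZMod q) :=
    (AddEquiv.prodCongr (ZMod.chineseRemainder h8).toAddEquiv
      (ZMod.chineseRemainder h4).toAddEquiv).trans (AddEquiv.prodProdProdComm _ _ _ _)
  have hH : ∀ t : ZMod p × ZMod q, t + t = 0 → t = 0 := fun t ht =>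
    Prod.ext (ZMod.eq_zero_of_add_self_eq_zero_of_odd hp _ (Prod.ext_iff.1 ht).1)
      (ZMod.eq_zero_of_add_self_eq_zero_of_odd hq _ (Prod.ext_iff.1 ht).2)
  have hrep : ∀ X ∈ F, ∃ x a b, a ≠ 0 ∧ b ≠ 0 ∧ a + b ≠ 0 ∧
      ∀ g, g ∈ X ↔ g = x ∨ g = x + a ∨ g = x + a + b := by
    intro X hX
    obtain ⟨x, y, z, hxy, hxz, hyz, rfl⟩ := card_eq_three.1 (hF.1 X hX)
    exact ⟨x, y - x, z - y, sub_ne_zero.2 hxy.symm, sub_ne_zero.2 hyz.symm,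
      by simpa [sub_ne_zero] using hxz.symm, by simp⟩
  choose! x a b ha hb hab hX using hrep
  have hdiff : ∀ X ∈ F, ∀ g ∈ tripleDiff (a X) (b X), ∃ u ∈ X, ∃ v ∈ X, u ≠ v ∧ g = u - v := by
    intro X hXF g hg
    have h1 : x X ∈ X := by simp [hX X hXF]
    have h2 : x X + a X ∈ X := by simp [hX X hXF]
    have h3 : x X + a X + b X ∈ X := by simp [hX X hXF]
    have ha' := ha X hXF
    have hb' := hb X hXF
    have hab' := hab X hXF
    rw [mem_tripleDiff] at hg
    rcases hg with rfl | rfl | rfl | rfl | rfl | rfl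
    · exact ⟨_, h2, _, h1, by simpa using ha', by abel⟩
    · exact ⟨_, h3, _, h2, by simpa using hb', by abel⟩
    · exact ⟨_, h3, _, h1, by simpa [add_assoc] using hab', by abel⟩
    · exact ⟨_, h1, _, h2, by simpa using ha', by abel⟩
    · exact ⟨_, h2, _, h3, by simpa using hb', by abel⟩
    · exact ⟨_, h1, _, h3, by simpa [add_assoc] using hab', by abel⟩
  have hmap : ∀ X, tripleDiff (e (a X)) (e (b X)) = (tripleDiff (a X) (b X)).map e.toEmbedding := by
    intro X
    simp [tripleDiff, map_insert]
  have key := two_mul_card_le_of_disjoint_tripleDiff hH F (fun X => e (a X)) (fun X => e (b X))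
    (fun X h => by simpa using ha X h) (fun X h => by simpa using hb X h)
    (fun X h => by simpa [← map_add] using hab X h) ?_ ?_
  · simp only [Fintype.card_prod, ZMod.card] at key
    have hodd : Odd (p * q) := hp.mul hq
    have : 13 * (8 * p) * (4 * q) = 416 * (p * q) := by ring
    rw [this]
    obtain ⟨c, hc⟩ := hodd
    omega
  · intro X hXF hEq h
    have hEq : a X = b X := e.injective hEq
    have h : a X + a X + a X = 0 := by simpa [← map_add] using h
    have himage : X.image (fun y => a X + y) = X := by
      have h1 : a X + (x X + a X) = x X + a X + a X := by abel
      have h2 : a X + (x X + a X + a X) = x X := by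
        calc a X + (x X + a X + a X) = x X + (a X + a X + a X) := by abel
          _ = x X := by rw [h, add_zero]
      ext g
      simp only [mem_image, hX X hXF, ← hEq, exists_eq_or_imp, exists_eq_left, h1, h2,
        add_comm (a X) (x X), eq_comm (b := g)]
      tauto
    have := hF.2.1 X hXF (a X) (ha X hXF)
    rw [himage, inter_self, hF.1 X hXF] at this
    omega
  · intro X hXF Y hYF hXY
    simp only [Function.onFun, hmap, disjoint_map]
    rw [disjoint_left]
    intro g hg hg'
    obtain ⟨u, hu, v, hv, hne, rfl⟩ := hdiff X hXF g hg
    obtain ⟨u', hu', v', hv', -, h⟩ := hdiff Y hYF _ hg'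
    exact hF.sub_ne_sub hXF hYF hXY hu hv hu' hv' hne h
end

section
/- For λ_a ∈ {2,3}, every (4,2,3,λ_a,1)-OOSPC has at most 1 codeword. -/
open Finset

set_option synthInstance.maxSize 2000 in
/-- Two triples `{0, a, b}` and `{0, c, d}` in `Z_4 x Z_2` always share a nonzero difference. -/
lemma exists_common_difference : ∀ a : ZMod 4 × ZMod 2, a ≠ 0 → ∀ b : ZMod 4 × ZMod 2, b ≠ 0 →
    a ≠ b → ∀ c : ZMod 4 × ZMod 2, c ≠ 0 → ∀ d : ZMod 4 × ZMod 2, d ≠ 0 → c ≠ d →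
    ∃ u ∈ [a, b, a - b, -a, -b, b - a], u ∈ [c, d, c - d] := by
  decide +kernel

lemma two_le_card_inter_image_add {G : Type*} [AddCommGroup G] [DecidableEq G] {X Y : Finset G}
    {x x' y y' : G} (hx : x ∈ X) (hx' : x' ∈ X) (hy : y ∈ Y) (hy' : y' ∈ Y) (hne : x ≠ x')
    (h : x - x' = y - y') : 2 ≤ (X ∩ Y.image (fun z => (x - y) + z)).card := by
  refine Finset.one_lt_card.2 ⟨x, ?_, x', ?_, hne⟩
  · exact mem_inter.2 ⟨hx, mem_image.2 ⟨y, hy, sub_add_cancel x y⟩⟩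
  · refine mem_inter.2 ⟨hx', mem_image.2 ⟨y', hy', ?_⟩⟩
    rw [← sub_eq_zero] at h ⊢
    rw [← h]
    abel

theorem stmt11 (lamA : ℕ) (hl : lamA = 2 ∨ lamA = 3)
    (F : Finset (Finset (ZMod 4 × ZMod 2))) (hF : OOSPC 4 2 3 lamA 1 F) :
    F.card ≤ 1 := by
  obtain ⟨hk, -, hc⟩ := hF
  refine Finset.card_le_one.2 fun X hX Y hY => ?_
  by_contra hXY
  have hdiff : ∀ x ∈ X, ∀ x' ∈ X, ∀ y ∈ Y, ∀ y' ∈ Y, x ≠ x' → x - x' ≠ y - y' := by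
    intro x hx x' hx' y hy y' hy' hne h
    have h2 := two_le_card_inter_image_add hx hx' hy hy' hne h
    have h1 := hc X hX Y hY hXY (x - y)
    omega
  obtain ⟨x, x₁, x₂, h01, h02, h12, hXe⟩ := Finset.card_eq_three.1 (hk X hX)
  obtain ⟨y, y₁, y₂, k01, k02, k12, hYe⟩ := Finset.card_eq_three.1 (hk Y hY)
  obtain ⟨u, hu, hv⟩ := exists_common_difference (x₁ - x) (sub_ne_zero.2 h01.symm)
    (x₂ - x) (sub_ne_zero.2 h02.symm) (fun h => h12 (sub_left_injective h))
    (y₁ - y) (sub_ne_zero.2 k01.symm) (y₂ - y) (sub_ne_zero.2 k02.symm)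
    (fun h => k12 (sub_left_injective h))
  have hu' : ∃ p ∈ X, ∃ q ∈ X, p ≠ q ∧ u = p - q := by
    simp only [List.mem_cons, List.not_mem_nil, or_false, sub_sub_sub_cancel_right, neg_sub] at hu
    subst hXe
    rcases hu with h | h | h | h | h | h
    · exact ⟨x₁, by simp, x, by simp, h01.symm, h⟩
    · exact ⟨x₂, by simp, x, by simp, h02.symm, h⟩
    · exact ⟨x₁, by simp, x₂, by simp, h12, h⟩
    · exact ⟨x, by simp, x₁, by simp, h01, h⟩
    · exact ⟨x, by simp, x₂, by simp, h02, h⟩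
    · exact ⟨x₂, by simp, x₁, by simp, h12.symm, h⟩
  have hv' : ∃ p ∈ Y, ∃ q ∈ Y, u = p - q := by
    simp only [List.mem_cons, List.not_mem_nil, or_false, sub_sub_sub_cancel_right] at hv
    subst hYe
    rcases hv with h | h | h
    · exact ⟨y₁, by simp, y, by simp, h⟩
    · exact ⟨y₂, by simp, y, by simp, h⟩
    · exact ⟨y₁, by simp, y₂, by simp, h⟩
  obtain ⟨p, hp, q, hq, hpq, hupq⟩ := hu'
  obtain ⟨r, hr, s, hs, hurs⟩ := hv'
  exact hdiff p hp q hq r hr s hs hpq (hupq.symm.trans hurs)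
end

section
/- Every (12,3,3,3,1)-OOSPC has at most 9 codewords. -/
open Finset

/-- Representatives, up to sign, of the nonzero elements of `Z_12 × Z_3` with even first
coordinate. -/
def evenReps : Finset (ZMod 12 × ZMod 3) :=
  {(0, 1), (2, 0), (2, 1), (2, 2), (4, 0), (4, 1), (4, 2), (6, 0), (6, 1)}

lemma mem_evenReps_or_neg_mem :
    ∀ d : ZMod 12 × ZMod 3, d ≠ 0 → d.1.val % 2 = 0 → d ∈ evenReps ∨ -d ∈ evenReps := by
  decide

lemma zero_notMem_evenReps : (0 : ZMod 12 × ZMod 3) ∉ evenReps := by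
  decide

lemma val_sub_mod_two :
    ∀ a b : ZMod 12, a.val % 2 = b.val % 2 → (a - b).val % 2 = 0 := by
  decide

/-- By the pigeonhole principle on parities, a set of three elements has a difference
in `evenReps`. -/
lemma exists_sub_mem_evenReps (X : Finset (ZMod 12 × ZMod 3)) (hX : X.card = 3) :
    ∃ d ∈ evenReps, ∃ x ∈ X, ∃ y ∈ X, x - y = d := by
  obtain ⟨x, hx, y, hy, hne, hxy⟩ :=
    Finset.exists_ne_map_eq_of_card_lt_of_maps_to (s := X) (t := Finset.range 2)
      (f := fun x => x.1.val % 2) (by simp [hX])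
      (fun x _ => Finset.mem_coe.2 (Finset.mem_range.2 (Nat.mod_lt _ two_pos)))
  rcases mem_evenReps_or_neg_mem (x - y) (sub_ne_zero.2 hne) (val_sub_mod_two _ _ hxy) with h | h
  · exact ⟨_, h, x, hx, y, hy, rfl⟩
  · exact ⟨_, h, y, hy, x, hx, (neg_sub x y).symm⟩

/-- Distinct members of an OOSPC with cross-correlation at most one share no nonzero
difference. -/
lemma OOSPC.eq_of_sub_eq_sub {m n k lamA : ℕ} {F : Finset (Finset (ZMod m × ZMod n))}
    (hF : OOSPC m n k lamA 1 F) {X Y : Finset (ZMod m × ZMod n)} (hX : X ∈ F) (hY : Y ∈ F)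
    {x y x' y' : ZMod m × ZMod n} (hx : x ∈ X) (hy : y ∈ X) (hx' : x' ∈ Y) (hy' : y' ∈ Y)
    (hne : x ≠ y) (h : x - y = x' - y') : X = Y := by
  by_contra hXY
  refine hne (Finset.card_le_one.1 (hF.2.2 X hX Y hY hXY (x - x')) x ?_ y ?_)
  · exact Finset.mem_inter.2 ⟨hx, Finset.mem_image.2 ⟨x', hx', sub_add_cancel x x'⟩⟩
  · refine Finset.mem_inter.2 ⟨hy, Finset.mem_image.2 ⟨y', hy', ?_⟩⟩
    linear_combination h

theorem stmt12 (F : Finset (Finset (ZMod 12 × ZMod 3)))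
    (hF : OOSPC 12 3 3 3 1 F) :
    F.card ≤ 9 := by
  classical
  choose! d hd x hx y hy hxy using fun X (hX : X ∈ F) => exists_sub_mem_evenReps X (hF.1 X hX)
  refine (Finset.card_le_card_of_injOn d hd fun X hX Y hY h => ?_).trans_eq
    (show evenReps.card = 9 by decide)
  refine hF.eq_of_sub_eq_sub hX hY (hx X hX) (hy X hX) (hx Y hY) (hy Y hY) (fun h0 => ?_)
    ((hxy X hX).trans (h.trans (hxy Y hY).symm))
  exact zero_notMem_evenReps (sub_eq_zero.2 h0 ▸ hxy X hX ▸ hd X hX)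
end

section
/- Every (12,3,3,2,1)-OOSPC has at most 7 codewords. -/
open Finset

/-- The nonzero differences of a finite set. -/
def nonzeroDifferences {G : Type*} [AddGroup G] [DecidableEq G] (X : Finset G) : Finset G :=
  ((X ×ˢ X).image fun p => p.1 - p.2).erase 0

theorem mem_nonzeroDifferences {G : Type*} [AddGroup G] [DecidableEq G] {X : Finset G} {d : G} :
    d ∈ nonzeroDifferences X ↔ d ≠ 0 ∧ ∃ x ∈ X, ∃ y ∈ X, x - y = d := by
  simp only [nonzeroDifferences, mem_erase, mem_image, mem_product, Prod.exists, and_assoc]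
  exact and_congr_right fun _ => by tauto

/-- Sets whose translates meet in at most one point have no common nonzero difference. -/
theorem disjoint_nonzeroDifferences {G : Type*} [AddCommGroup G] [DecidableEq G] {X Y : Finset G}
    (h : ∀ g : G, (X ∩ Y.image (fun x => g + x)).card ≤ 1) :
    Disjoint (nonzeroDifferences X) (nonzeroDifferences Y) := by
  rw [Finset.disjoint_left]
  intro d hX hY
  obtain ⟨hd, x, hx, x', hx', hxd⟩ := mem_nonzeroDifferences.1 hX
  obtain ⟨-, y, hy, y', hy', hyd⟩ := mem_nonzeroDifferences.1 hY
  have hx1 : x ∈ X ∩ Y.image (fun t => (x - y) + t) :=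
    mem_inter.2 ⟨hx, mem_image.2 ⟨y, hy, by abel⟩⟩
  have hx2 : x' ∈ X ∩ Y.image (fun t => (x - y) + t) := by
    refine mem_inter.2 ⟨hx', mem_image.2 ⟨y', hy', ?_⟩⟩
    rw [← hyd] at hxd
    rw [← sub_eq_zero] at hxd ⊢
    rw [← hxd]
    abel
  have := Finset.card_le_one.1 (h (x - y)) x hx1 x' hx2
  exact hd (by rw [← hxd, this, sub_self])

/-- Weights on `ZMod 12 × ZMod 3`: `4` on the involution, `2` on elements of order `6`,
and `1` on all other nonzero elements. -/
def differenceWeight (d : ZMod 12 × ZMod 3) : ℕ :=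
  if d = 0 then 0 else if d + d = 0 then 4 else if d + d + d + (d + d + d) = 0 ∧ d + d + d ≠ 0
    then 2 else 1

theorem sum_differenceWeight : ∑ d, differenceWeight d = 46 := by
  decide +kernel

theorem six_le_sum_differenceWeight_triple : ∀ a b : ZMod 12 × ZMod 3,
    a ≠ 0 → b ≠ 0 → a ≠ b → ¬ (a + b = 0 ∧ a + a = b) →
    6 ≤ ∑ d ∈ ({a, -a, b, -b, a - b, b - a} : Finset (ZMod 12 × ZMod 3)),
      differenceWeight d := by
  decide +kernel

/-- A triple that is not a coset of a subgroup of order `3` has differences of weight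
at least `6`. -/
theorem six_le_sum_differenceWeight {X : Finset (ZMod 12 × ZMod 3)} (hX : X.card = 3)
    (hauto : ∀ g : ZMod 12 × ZMod 3, g ≠ 0 → (X ∩ X.image (fun x => g + x)).card ≤ 2) :
    6 ≤ ∑ d ∈ nonzeroDifferences X, differenceWeight d := by
  obtain ⟨x, y, z, hxy, hxz, hyz, rfl⟩ := Finset.card_eq_three.1 hX
  have ha : y - x ≠ 0 := sub_ne_zero.2 hxy.symm
  have hb : z - x ≠ 0 := sub_ne_zero.2 hxz.symm
  have hab : y - x ≠ z - x := fun h => hyz (sub_left_injective h)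
  refine (six_le_sum_differenceWeight_triple (y - x) (z - x) ha hb hab ?_).trans
    (Finset.sum_le_sum_of_subset ?_)
  · rintro ⟨h0, h1⟩
    have hz : (y - x) + y = z := by
      rw [← sub_eq_zero] at h1 ⊢
      rw [← h1]
      abel
    have hx : (y - x) + z = x := by
      rw [← sub_eq_zero, ← h0]
      abel
    have himage : ({x, y, z} : Finset (ZMod 12 × ZMod 3)).image (fun t => (y - x) + t)
        = {x, y, z} := by
      simp only [image_insert, image_singleton, sub_add_cancel, hz, hx]
      ext t
      simp only [mem_insert, mem_singleton]
      tauto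
    have := hauto (y - x) ha
    rw [himage, inter_self, hX] at this
    omega
  · intro d hd
    simp only [mem_insert, mem_singleton, neg_sub, sub_sub_sub_cancel_right] at hd
    rw [mem_nonzeroDifferences]
    rcases hd with rfl | rfl | rfl | rfl | rfl | rfl
    · exact ⟨ha, y, by simp, x, by simp, rfl⟩
    · exact ⟨sub_ne_zero.2 hxy, x, by simp, y, by simp, rfl⟩
    · exact ⟨hb, z, by simp, x, by simp, rfl⟩
    · exact ⟨sub_ne_zero.2 hxz, x, by simp, z, by simp, rfl⟩
    · exact ⟨sub_ne_zero.2 hyz, y, by simp, z, by simp, rfl⟩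
    · exact ⟨sub_ne_zero.2 hyz.symm, z, by simp, y, by simp, rfl⟩

theorem stmt13 (F : Finset (Finset (ZMod 12 × ZMod 3)))
    (hF : OOSPC 12 3 3 2 1 F) :
    F.card ≤ 7 := by
  obtain ⟨hcard, hauto, hcross⟩ := hF
  have hdisj : (F : Set (Finset (ZMod 12 × ZMod 3))).PairwiseDisjoint nonzeroDifferences :=
    fun X hX Y hY hXY => disjoint_nonzeroDifferences (hcross X hX Y hY hXY)
  have hlower : F.card * 6 ≤ ∑ X ∈ F, ∑ d ∈ nonzeroDifferences X, differenceWeight d := by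
    rw [← smul_eq_mul]
    exact Finset.card_nsmul_le_sum _ _ _ fun X hX =>
      six_le_sum_differenceWeight (hcard X hX) (hauto X hX)
  have hupper : ∑ X ∈ F, ∑ d ∈ nonzeroDifferences X, differenceWeight d ≤ 46 := by
    rw [← Finset.sum_biUnion hdisj, ← sum_differenceWeight]
    exact Finset.sum_le_sum_of_subset (subset_univ _)
  omega
end

section
/- Let m and n be positive integers such that 3 does not divide mn, and let 𝓕 be a finite family of 3-element subsets of Z_m × Z_n. Then 𝓕 is an (m,n,3,2,1)-OOSPC if and only if 𝓕 is an (m,n,3,3,1)-OOSPC. -/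
open Finset

/-- A translation fixing a finite set whose size is coprime to the order of the group is trivial. -/
theorem eq_zero_of_image_add_left_eq {G : Type*} [AddCommGroup G] [DecidableEq G]
    {X : Finset G} (hX : X.card.Coprime (Nat.card G)) {g : G}
    (h : X.image (fun x => g + x) = X) : g = 0 := by
  have hsum : ∑ x ∈ X, (g + x) = ∑ x ∈ X, x := by
    conv_rhs => rw [← h, Finset.sum_image fun _ _ _ _ => add_left_cancel]
  rw [Finset.sum_add_distrib, Finset.sum_const, add_eq_right] at hsum
  exact AddMonoid.addOrderOf_eq_one_iff.mp <| Nat.dvd_one.mp <| hX ▸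
    Nat.dvd_gcd (addOrderOf_dvd_of_nsmul_eq_zero hsum) (addOrderOf_dvd_natCard g)

theorem card_inter_image_add_left_lt {G : Type*} [AddCommGroup G] [DecidableEq G]
    {X : Finset G} (hX : X.card.Coprime (Nat.card G)) {g : G} (hg : g ≠ 0) :
    (X ∩ X.image (fun x => g + x)).card < X.card := by
  refine lt_of_le_of_ne (Finset.card_le_card Finset.inter_subset_left) fun hcard => hg ?_
  have hsub : X ⊆ X.image (fun x => g + x) := Finset.inter_eq_left.mp <|
    Finset.eq_of_subset_of_card_le Finset.inter_subset_left hcard.ge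
  exact eq_zero_of_image_add_left_eq hX
    (Finset.eq_of_subset_of_card_le hsub Finset.card_image_le).symm

theorem stmt14 (m n : ℕ) (hm : 0 < m) (hn : 0 < n) (h3 : ¬ 3 ∣ m * n)
    (F : Finset (Finset (ZMod m × ZMod n))) (hcard : ∀ X ∈ F, X.card = 3) :
    OOSPC m n 3 2 1 F ↔ OOSPC m n 3 3 1 F := by
  refine and_congr_right fun _ => and_congr_left fun _ => forall₂_congr fun X hX =>
    forall₂_congr fun g hg => ⟨fun h => h.trans (Nat.le_succ 2), fun _ => ?_⟩
  have hcop : X.card.Coprime (Nat.card (ZMod m × ZMod n)) := by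
    rw [hcard X hX, Nat.card_prod, Nat.card_zmod, Nat.card_zmod]
    exact (Nat.Prime.coprime_iff_not_dvd Nat.prime_three).mpr h3
  exact Nat.le_of_lt_succ ((card_inter_image_add_left_lt hcop hg).trans_eq (hcard X hX))
end

section
/- Let m and n be positive integers with m ≡ 2 (mod 4) and n ≡ 2 (mod 4). If there exists an (m/2,n/2,3,1,1)-OOSPC with b codewords, then there exists an (m,n,3,2,1)-OOSPC with 5b codewords. Moreover, if the given (m/2,n/2,3,1,1)-OOSPC is (s,t)-regular, then the (m,n,3,2,1)-OOSPC can be taken to be (2s,2t)-regular. -/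
open Finset

/-- Two pairs of elements of codewords with the same nonzero difference coincide. -/
lemma OOSPC.eq_of_sub_eq {m n k : ℕ} {F : Finset (Finset (ZMod m × ZMod n))}
    (hF : OOSPC m n k 1 1 F) {X Y : Finset (ZMod m × ZMod n)} (hX : X ∈ F) (hY : Y ∈ F)
    {x x' y y' : ZMod m × ZMod n} (hx : x ∈ X) (hx' : x' ∈ X) (hy : y ∈ Y) (hy' : y' ∈ Y)
    (hne : x ≠ x') (h : x - x' = y - y') : X = Y ∧ x = y ∧ x' = y' := by
  have h1 : x ∈ X ∩ Y.image (fun z => (x - y) + z) :=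
    mem_inter.2 ⟨hx, mem_image.2 ⟨y, hy, by abel⟩⟩
  have h2 : x' ∈ X ∩ Y.image (fun z => (x - y) + z) :=
    mem_inter.2 ⟨hx', mem_image.2 ⟨y', hy', by
      have : x' = x - (y - y') := by rw [← h]; abel
      rw [this]; abel⟩⟩
  have key : ¬ (X ∩ Y.image (fun z => (x - y) + z)).card ≤ 1 := fun hc =>
    hne (card_le_one.1 hc x h1 x' h2)
  have hXY : X = Y := by
    by_contra hXY
    exact key (hF.2.2 X hX Y hY hXY _)
  subst hXY
  have hxy : x = y := by
    by_contra hxy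
    exact key (hF.2.1 X hX _ (sub_ne_zero.2 hxy))
  subst hxy
  exact ⟨rfl, rfl, by simpa using h⟩

/-- The three cyclic differences of every codeword of an OOSPC with parameters `(m,n,3,1,1)`. -/
lemma OOSPC.exists_cyclic_differences {m n : ℕ} {F : Finset (Finset (ZMod m × ZMod n))}
    (hF : OOSPC m n 3 1 1 F) :
    ∃ d : F → Fin 3 → ZMod m × ZMod n,
      (∀ X, d X 0 + d X 1 + d X 2 = 0) ∧ (∀ X k, d X k ≠ 0) ∧
      (∀ X Y k l, d X k = d Y l ∨ d X k = -d Y l → X = Y ∧ k = l) ∧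
      ∀ g, (g ≠ 0 ∧ ∃ X ∈ F, ∃ x ∈ X, ∃ y ∈ X, x - y = g) ↔
        ∃ X k, g = d X k ∨ g = -d X k := by
  have hel : ∀ X : F, ∃ p : Fin 3 → ZMod m × ZMod n, Function.Injective p ∧
      ∀ x, x ∈ X.1 ↔ ∃ i, p i = x := by
    intro X
    let u := X.1.equivFinOfCardEq (hF.1 X.1 X.2)
    refine ⟨fun i => (u.symm i).1, fun i j h => u.symm.injective (Subtype.ext h), fun x => ?_⟩
    refine ⟨fun hx => ⟨u ⟨x, hx⟩, by simp⟩, ?_⟩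
    rintro ⟨i, rfl⟩
    exact (u.symm i).2
  choose p hp hmem using hel
  have hpm : ∀ X i, p X i ∈ X.1 := fun X i => (hmem X _).2 ⟨i, rfl⟩
  have hne : ∀ X k, p X (k + 1) ≠ p X k := fun X k h => by
    exact absurd (hp X h) ((by decide : ∀ k : Fin 3, k + 1 ≠ k) k)
  refine ⟨fun X k => p X (k + 1) - p X k, fun X => ?_, fun X k => sub_ne_zero.2 (hne X k), ?_, ?_⟩
  · have h1 : (0 : Fin 3) + 1 = 1 := rfl
    have h2 : (1 : Fin 3) + 1 = 2 := rfl
    have h3 : (2 : Fin 3) + 1 = 0 := rfl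
    simp only [h1, h2, h3]
    abel
  · rintro X Y k l (h | h)
    · obtain ⟨h1, h2, h3⟩ := hF.eq_of_sub_eq X.2 Y.2 (hpm X _) (hpm X _) (hpm Y _) (hpm Y _)
        (hne X k) h
      obtain rfl := Subtype.ext h1
      exact ⟨rfl, hp X h3⟩
    · simp only [neg_sub] at h
      obtain ⟨h1, h2, h3⟩ := hF.eq_of_sub_eq X.2 Y.2 (hpm X _) (hpm X _) (hpm Y _) (hpm Y _)
        (hne X k) h
      obtain rfl := Subtype.ext h1
      exact ((by decide : ∀ k l : Fin 3, k + 1 = l → k ≠ l + 1) k l (hp X h2) (hp X h3)).elim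
  · intro g
    constructor
    · rintro ⟨hg, X, hX, x, hx, y, hy, rfl⟩
      obtain ⟨i, rfl⟩ := (hmem ⟨X, hX⟩ x).1 hx
      obtain ⟨j, rfl⟩ := (hmem ⟨X, hX⟩ y).1 hy
      have hij : i ≠ j := by
        rintro rfl
        simp at hg
      rcases (by decide : ∀ i j : Fin 3, i ≠ j → i = j + 1 ∨ j = i + 1) i j hij with rfl | rfl
      · exact ⟨⟨X, hX⟩, j, Or.inl rfl⟩
      · exact ⟨⟨X, hX⟩, i, Or.inr (neg_sub _ _).symm⟩
    · rintro ⟨X, k, rfl | rfl⟩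
      · exact ⟨sub_ne_zero.2 (hne X k), X.1, X.2, _, hpm X _, _, hpm X _, rfl⟩
      · exact ⟨neg_ne_zero.2 (sub_ne_zero.2 (hne X k)), X.1, X.2, _, hpm X _, _, hpm X _,
          (neg_sub _ _).symm⟩

/-- The Klein four-group. -/
abbrev Klein : Type := ZMod 2 × ZMod 2

section Construction

variable {H : Type*} [AddCommGroup H]

/-- The second point of each of the five triples built from the differences `d`. -/
def secondPoint (d : Fin 3 → H) : Fin 5 → H × Klein :=
  ![(d 0, 1, 0), (d 1, 0, 1), (d 2, 1, 1), (d 0, 0, 1), (d 0, 1, 1)]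

/-- The third point of each of the five triples built from the differences `d`. -/
def thirdPoint (d : Fin 3 → H) : Fin 5 → H × Klein :=
  ![(d 0 + d 0, 0), (d 1 + d 1, 0), (d 2 + d 2, 0), (-d 2, 1, 0), (-d 2, 0, 1)]

/-- The five triples in `H × Klein` built from the differences `d`. -/
def fiveTriples [DecidableEq H] (d : Fin 3 → H) (p : Fin 5) : Finset (H × Klein) :=
  {0, secondPoint d p, thirdPoint d p}

/-- The Klein component with which `± d k` occurs as a difference of the `p`-th triple,
or `0` if it does not occur. -/
def klein : Fin 5 → Fin 3 → Klein :=
  ![![(1, 0), 0, 0], ![0, (0, 1), 0], ![0, 0, (1, 1)],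
    ![(0, 1), (1, 1), (1, 0)], ![(1, 1), (1, 0), (0, 1)]]

lemma klein_injective : ∀ p q k, klein p k ≠ 0 → klein p k = klein q k → p = q := by
  decide

lemma klein_surjective : ∀ k, ∀ v : Klein, v ≠ 0 → ∃ p, klein p k = v := by
  decide

lemma points_ne {d : Fin 3 → H} (h2 : ∀ k, d k + d k ≠ 0) (p : Fin 5) :
    secondPoint d p ≠ 0 ∧ thirdPoint d p ≠ 0 ∧ secondPoint d p ≠ thirdPoint d p := by
  fin_cases p <;> simp [secondPoint, thirdPoint, Prod.ext_iff, h2]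

lemma card_fiveTriples [DecidableEq H] {d : Fin 3 → H} (h2 : ∀ k, d k + d k ≠ 0) (p : Fin 5) :
    (fiveTriples d p).card = 3 := by
  obtain ⟨h1, h2, h3⟩ := points_ne h2 p
  exact card_eq_three.2 ⟨_, _, _, h1.symm, h2.symm, h3, rfl⟩

lemma exists_sub_triple_iff {A : Type*} [AddCommGroup A] [DecidableEq A] {P Q : A} (h1 : P ≠ 0)
    (h2 : Q ≠ 0) (h3 : P ≠ Q) (g : A) :
    (g ≠ 0 ∧ ∃ x ∈ ({0, P, Q} : Finset A), ∃ y ∈ ({0, P, Q} : Finset A), x - y = g) ↔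
      g = P ∨ g = -P ∨ g = Q ∨ g = -Q ∨ g = P - Q ∨ g = -(P - Q) := by
  constructor
  · rintro ⟨hg, x, hx, y, hy, rfl⟩
    simp only [mem_insert, mem_singleton] at hx hy
    rcases hx with rfl | rfl | rfl <;> rcases hy with rfl | rfl | rfl <;> simp_all
  · have h4 := sub_ne_zero.2 h3
    rintro (rfl | rfl | rfl | rfl | rfl | rfl)
    · exact ⟨h1, g, by simp, 0, by simp, by simp⟩
    · exact ⟨neg_ne_zero.2 h1, 0, by simp, P, by simp, by simp⟩
    · exact ⟨h2, g, by simp, 0, by simp, by simp⟩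
    · exact ⟨neg_ne_zero.2 h2, 0, by simp, Q, by simp, by simp⟩
    · exact ⟨h4, P, by simp, Q, by simp, by simp⟩
    · exact ⟨neg_ne_zero.2 h4, Q, by simp, P, by simp, by simp⟩

lemma exists_sub_fiveTriples_iff [DecidableEq H] {d : Fin 3 → H} (h0 : d 0 + d 1 + d 2 = 0)
    (h2 : ∀ k, d k + d k ≠ 0) (p : Fin 5) (g : H × Klein) :
    (g ≠ 0 ∧ ∃ x ∈ fiveTriples d p, ∃ y ∈ fiveTriples d p, x - y = g) ↔
      (∃ k, klein p k ≠ 0 ∧ g.2 = klein p k ∧ (g.1 = d k ∨ g.1 = -d k)) ∨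
      ∃ k : Fin 3, p = k.castLE (by decide) ∧ g.2 = 0 ∧
        (g.1 = d k + d k ∨ g.1 = -(d k + d k)) := by
  obtain ⟨h3, h4, h5⟩ := points_ne h2 p
  rw [fiveTriples, exists_sub_triple_iff h3 h4 h5]
  have hd : d 0 + d 2 = - d 1 := by
    rw [eq_neg_iff_add_eq_zero, ← h0]; abel
  obtain ⟨h, v⟩ := g
  fin_cases p <;>
    simp [secondPoint, thirdPoint, klein, Prod.ext_iff, Fin.exists_fin_succ, hd] <;>
    grind

lemma fiveTriples_shift [DecidableEq H] {d : Fin 3 → H} (h2 : ∀ k, d k + d k ≠ 0) (p : Fin 5)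
    (g : H × Klein)
    (hg : fiveTriples d p ⊆ (fiveTriples d p).image (fun x => g + x)) : g = 0 := by
  have heq := eq_of_subset_of_card_le hg card_image_le
  have hs : ∑ x ∈ fiveTriples d p, x = 3 • g + ∑ x ∈ fiveTriples d p, x := by
    conv_lhs => rw [heq]
    rw [sum_image (fun _ _ _ _ h => add_left_cancel h), sum_add_distrib, sum_const,
      card_fiveTriples h2]
  have h3 : 3 • g = 0 := by simpa using hs
  have hv : g.2 = 0 := by
    have : ∀ v : Klein, 3 • v = 0 → v = 0 := by decide
    exact this _ (congrArg Prod.snd h3)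
  have hP : secondPoint d p ∈ fiveTriples d p := by simp [fiveTriples]
  obtain ⟨x, hx, hxP⟩ := mem_image.1 (hg hP)
  have hx2 : x.2 = (secondPoint d p).2 := by
    rw [← hxP, Prod.snd_add, hv, zero_add]
  have hxeq : x = secondPoint d p := by
    simp only [fiveTriples, mem_insert, mem_singleton] at hx
    rcases hx with rfl | rfl | rfl
    · fin_cases p <;> simp [secondPoint, Prod.ext_iff] at hx2
    · rfl
    · fin_cases p <;> simp [secondPoint, thirdPoint, Prod.ext_iff] at hx2
  rw [hxeq] at hxP
  simpa using hxP

end Construction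

/-- A family of triples with pairwise disjoint difference sets, none fixed by a nonzero
translation, transports to an OOSPC with parameters `(m,n,3,2,1)`. -/
lemma oospc_image_of_disjoint_differences {m n : ℕ} {A ι : Type*} [AddCommGroup A] [DecidableEq A]
    [Fintype ι] (e : A ≃+ ZMod m × ZMod n) (c : ι → Finset A) (hcard : ∀ i, (c i).card = 3)
    (hshift : ∀ i g, c i ⊆ (c i).image (fun x => g + x) → g = 0)
    (hdisj : ∀ i j, ∀ x ∈ c i, ∀ x' ∈ c i, ∀ y ∈ c j, ∀ y' ∈ c j,
      x ≠ x' → x - x' = y - y' → i = j) :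
    OOSPC m n 3 2 1 (univ.image fun i => (c i).map e.toEquiv.toEmbedding) ∧
      (univ.image fun i => (c i).map e.toEquiv.toEmbedding).card = Fintype.card ι := by
  refine ⟨⟨?_, ?_, ?_⟩, ?_⟩
  · simp [hcard]
  · simp only [mem_image, mem_univ, true_and, forall_exists_index, forall_apply_eq_imp_iff]
    intro i g hg
    by_contra! hlt
    set X := (c i).map e.toEquiv.toEmbedding with hX
    have hXc : X.card = 3 := by rw [hX, card_map, hcard]
    have hsub : X ⊆ X.image (fun x => g + x) :=
      inter_eq_left.1 (eq_of_subset_of_card_le inter_subset_left (by omega))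
    apply hg
    have := hshift i (e.symm g) (fun x hx => by
      obtain ⟨y, hy, hyx⟩ := mem_image.1 (hsub (mem_map_of_mem _ hx))
      obtain ⟨z, hz, rfl⟩ := mem_map.1 hy
      refine mem_image.2 ⟨z, hz, e.injective ?_⟩
      simpa using hyx)
    simpa using this
  · simp only [mem_image, mem_univ, true_and, forall_exists_index, forall_apply_eq_imp_iff]
    intro i j hij g
    rw [card_le_one]
    intro a ha a' ha'
    simp only [mem_inter, mem_image, mem_map] at ha ha'
    obtain ⟨⟨x, hx, rfl⟩, _, ⟨y, hy, rfl⟩, hxy⟩ := ha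
    obtain ⟨⟨x', hx', rfl⟩, _, ⟨y', hy', rfl⟩, hxy'⟩ := ha'
    by_contra hne
    refine hij ?_
    rw [hdisj i j x hx x' hx' y hy y' hy' (fun h => hne (by rw [h])) (e.injective ?_)]
    simp only [AddEquiv.toEquiv_eq_coe, Equiv.coe_toEmbedding, EquivLike.coe_coe] at hxy hxy'
    rw [map_sub, map_sub, ← hxy, ← hxy']
    abel
  · rw [card_image_of_injective, card_univ]
    intro i j hij
    have hij := map_injective _ hij
    obtain ⟨x, hx, y, hy, hxy⟩ := one_lt_card.1 (by rw [hcard i]; norm_num : 1 < (c i).card)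
    exact hdisj i j x hx y hy x (hij ▸ hx) y (hij ▸ hy) hxy rfl

/-- For odd `a`, the Chinese remainder isomorphism splitting off the factor `2`. -/
lemma exists_addEquiv_zmod_two_mul {a : ℕ} (ha : Odd a) :
    Nonempty (ZMod a × ZMod 2 ≃+ ZMod (2 * a)) :=
  ⟨((ZMod.ringEquivCongr (mul_comm 2 a)).trans
    (ZMod.chineseRemainder (Nat.coprime_two_right.2 ha))).symm.toAddEquiv⟩

lemma zmod_add_self_bijective {a : ℕ} (ha : Odd a) :
    Function.Bijective (fun x : ZMod a => x + x) := by
  have hu : IsUnit ((2 : ℕ) : ZMod a) := (ZMod.isUnit_iff_coprime 2 a).2 (Nat.coprime_two_left.2 ha)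
  simpa [two_mul] using IsUnit.isUnit_iff_mulLeft_bijective.1 hu

/-- `2 * s` kills an element of `ZMod (2 * a)` iff `s` kills its component in `ZMod a`. -/
lemma two_mul_nsmul_eq_zero_iff {a : ℕ} (ha : Odd a) (e : ZMod a × ZMod 2 ≃+ ZMod (2 * a))
    (s : ℕ) (x : ZMod a) (u : ZMod 2) : (2 * s) • e (x, u) = 0 ↔ s • x = 0 := by
  rw [← map_nsmul, map_eq_zero_iff e e.injective, Prod.smul_mk, Prod.mk_eq_zero, mul_nsmul',
    mul_nsmul]
  have hu : ∀ w : ZMod 2, 2 • w = 0 := by decide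
  rw [hu]
  refine ⟨fun h => (zmod_add_self_bijective ha).1 ?_, fun h => by simp [h]⟩
  simpa [two_mul] using h.1

lemma exists_oospc_two_mul {a b : ℕ} (ha : Odd a) (hb : Odd b)
    {F : Finset (Finset (ZMod a × ZMod b))} (hF : OOSPC a b 3 1 1 F) :
    ∃ G : Finset (Finset (ZMod (2 * a) × ZMod (2 * b))),
      OOSPC (2 * a) (2 * b) 3 2 1 G ∧ G.card = 5 * F.card ∧
      ∀ s t : ℕ, Regular a b s t F → Regular (2 * a) (2 * b) (2 * s) (2 * t) G := by
  obtain ⟨d, h0, hd0, hinj, hdiff⟩ := hF.exists_cyclic_differences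
  obtain ⟨e₁⟩ := exists_addEquiv_zmod_two_mul ha
  obtain ⟨e₂⟩ := exists_addEquiv_zmod_two_mul hb
  have hbij : Function.Bijective (fun h : ZMod a × ZMod b => h + h) :=
    (zmod_add_self_bijective ha).prodMap (zmod_add_self_bijective hb)
  have hd2 : ∀ X k, d X k + d X k ≠ 0 := fun X k h =>
    hd0 X k (hbij.1 (by simpa using h))
  let e : (ZMod a × ZMod b) × Klein ≃+ ZMod (2 * a) × ZMod (2 * b) :=
    AddEquiv.prodProdProdComm _ _ _ _ |>.trans (e₁.prodCongr e₂)
  have he : ∀ h v, e (h, v) = (e₁ (h.1, v.1), e₂ (h.2, v.2)) := fun h v => rfl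
  let c : F × Fin 5 → Finset ((ZMod a × ZMod b) × Klein) := fun q => fiveTriples (d q.1) q.2
  have hc := oospc_image_of_disjoint_differences e c
    (fun q => card_fiveTriples (hd2 q.1) q.2)
    (fun q => fiveTriples_shift (hd2 q.1) q.2) (by
      rintro ⟨X, p⟩ ⟨Y, q⟩ x hx x' hx' y hy y' hy' hne heq
      have h1 := (exists_sub_fiveTriples_iff (h0 X) (hd2 X) p (x - x')).1
        ⟨sub_ne_zero.2 hne, x, hx, x', hx', rfl⟩
      have h2 := (exists_sub_fiveTriples_iff (h0 Y) (hd2 Y) q (x - x')).1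
        ⟨sub_ne_zero.2 hne, y, hy, y', hy', heq.symm⟩
      generalize x - x' = g at h1 h2
      rcases h1 with ⟨k, hk, hgk, h1⟩ | ⟨k, hk, hgk, h1⟩ <;>
        rcases h2 with ⟨l, hl, hgl, h2⟩ | ⟨l, hl, hgl, h2⟩
      · have : X = Y ∧ k = l := hinj X Y k l (by
          rcases h1 with h1 | h1 <;> rcases h2 with h2 | h2 <;> rw [h1] at h2
          · exact Or.inl h2
          · exact Or.inr h2
          · exact Or.inr (neg_eq_iff_eq_neg.1 h2)
          · exact Or.inl (neg_injective h2))
        obtain ⟨rfl, rfl⟩ := this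
        rw [klein_injective p q k hk (hgk.symm.trans hgl)]
      · exact absurd (hgk.symm.trans hgl) hk
      · exact absurd (hgl.symm.trans hgk) hl
      · have : X = Y ∧ k = l := hinj X Y k l (by
          rcases h1 with h1 | h1 <;> rcases h2 with h2 | h2 <;> rw [h1] at h2
          · exact Or.inl (hbij.1 h2)
          · exact Or.inr (hbij.1 (h2.trans (neg_add _ _)))
          · exact Or.inr (hbij.1 ((neg_eq_iff_eq_neg.1 h2).trans (neg_add _ _)))
          · exact Or.inl (hbij.1 (neg_injective h2)))
        obtain ⟨rfl, rfl⟩ := this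
        rw [hk, hl])
  refine ⟨_, hc.1, ?_, fun s t hR => ?_⟩
  · rw [hc.2, Fintype.card_prod, Fintype.card_coe, Fintype.card_fin, mul_comm]
  have hK : ∀ h : ZMod a × ZMod b,
      (∃ X k, h = d X k ∨ h = -d X k) ↔ ¬ (s • h.1 = 0 ∧ t • h.2 = 0) := by
    intro h
    have := Set.ext_iff.1 hR h
    simp only [Set.mem_insert_iff, leave, Set.mem_ofPred_eq] at this
    rw [← hdiff, ← this]
    by_cases h0 : h = 0 <;> simp [h0]
  have hK2 : ∀ h : ZMod a × ZMod b, (s • (h + h).1 = 0 ∧ t • (h + h).2 = 0) ↔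
      (s • h.1 = 0 ∧ t • h.2 = 0) := by
    intro h
    have := hbij.1.eq_iff (a := (s • h.1, t • h.2)) (b := 0)
    simpa [Prod.ext_iff, ← mul_add] using this
  have key : ∀ g : (ZMod a × ZMod b) × Klein,
      (g ≠ 0 ∧ ∃ q, ∃ x ∈ c q, ∃ y ∈ c q, x - y = g) ↔ ¬ (s • g.1.1 = 0 ∧ t • g.1.2 = 0) := by
    rintro ⟨h, v⟩
    have h1 : ((h, v) ≠ (0 : (ZMod a × ZMod b) × Klein) ∧
        ∃ q, ∃ x ∈ c q, ∃ y ∈ c q, x - y = (h, v)) ↔ ∃ q : F × Fin 5, _ :=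
      exists_and_left.symm.trans (exists_congr fun q =>
        exists_sub_fiveTriples_iff (h0 q.1) (hd2 q.1) q.2 (h, v))
    rw [h1]
    by_cases hv : v = 0
    · subst hv
      obtain ⟨h, rfl⟩ := hbij.2 h
      simp only
      rw [hK2, ← hK]
      constructor
      · rintro ⟨⟨X, p⟩, ⟨k, hk, hk', -⟩ | ⟨k, -, -, h2 | h2⟩⟩
        · exact absurd hk'.symm hk
        · exact ⟨X, k, Or.inl (hbij.1 h2)⟩
        · exact ⟨X, k, Or.inr (hbij.1 (h2.trans (neg_add _ _)))⟩
      · rintro ⟨X, k, rfl | rfl⟩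
        · exact ⟨(X, k.castLE (by decide)), Or.inr ⟨k, rfl, trivial, Or.inl rfl⟩⟩
        · exact ⟨(X, k.castLE (by decide)), Or.inr ⟨k, rfl, trivial, Or.inr (neg_add _ _).symm⟩⟩
    · rw [← hK]
      constructor
      · rintro ⟨⟨X, p⟩, ⟨k, -, -, h2⟩ | ⟨k, -, hv0, -⟩⟩
        · exact ⟨X, k, h2⟩
        · exact absurd hv0 hv
      · rintro ⟨X, k, h2⟩
        obtain ⟨p, rfl⟩ := klein_surjective k v hv
        exact ⟨(X, p), Or.inl ⟨k, hv, rfl, h2⟩⟩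
  ext y
  obtain ⟨⟨h, v⟩, rfl⟩ := e.surjective y
  have h3 : (∃ q, ∃ x ∈ c q, ∃ y ∈ c q, x - y = (h, v)) ↔
      ∃ X ∈ univ.image fun i => (c i).map e.toEquiv.toEmbedding, ∃ x ∈ X, ∃ y ∈ X,
        x - y = e (h, v) := by
    constructor
    · rintro ⟨q, x, hx, y, hy, hxy⟩
      exact ⟨_, mem_image_of_mem _ (mem_univ q), e x, mem_map_of_mem _ hx, e y,
        mem_map_of_mem _ hy, by rw [← map_sub, hxy]⟩
    · rintro ⟨X, hX, x, hx, y, hy, hxy⟩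
      obtain ⟨q, -, rfl⟩ := mem_image.1 hX
      obtain ⟨x, hx', rfl⟩ := mem_map.1 hx
      obtain ⟨y, hy', rfl⟩ := mem_map.1 hy
      exact ⟨q, x, hx', y, hy', e.injective ((map_sub e x y).trans hxy)⟩
  have h4 := key (h, v)
  rw [h3] at h4
  have h5 : s • h.1 = 0 ∧ t • h.2 = 0 ↔
      (2 * s) • (e (h, v)).1 = 0 ∧ (2 * t) • (e (h, v)).2 = 0 := by
    rw [he, two_mul_nsmul_eq_zero_iff ha, two_mul_nsmul_eq_zero_iff hb]
  rw [h5, ← e.map_ne_zero_iff] at h4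
  simp only [Set.mem_insert_iff, leave, Set.mem_ofPred_eq]
  rw [← not_iff_not, ← h4]
  push Not
  constructor
  · rintro ⟨hne, h⟩
    exact ⟨hne, h hne⟩
  · rintro ⟨hne, h⟩
    exact ⟨hne, fun _ => h⟩

theorem stmt16 (m n b : ℕ) (hm : 0 < m) (hn : 0 < n)
    (hm4 : m % 4 = 2) (hn4 : n % 4 = 2)
    (F : Finset (Finset (ZMod (m / 2) × ZMod (n / 2))))
    (hF : OOSPC (m / 2) (n / 2) 3 1 1 F) (hb : F.card = b) :
    (∃ G : Finset (Finset (ZMod m × ZMod n)), OOSPC m n 3 2 1 G ∧ G.card = 5 * b) ∧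
    (∀ s t : ℕ, Regular (m / 2) (n / 2) s t F →
      ∃ G : Finset (Finset (ZMod m × ZMod n)),
        OOSPC m n 3 2 1 G ∧ G.card = 5 * b ∧ Regular m n (2 * s) (2 * t) G) := by
  obtain ⟨a, rfl⟩ : 2 ∣ m := by omega
  obtain ⟨c, rfl⟩ : 2 ∣ n := by omega
  have ha : 2 * a / 2 = a := by omega
  have hc : 2 * c / 2 = c := by omega
  revert F
  rw [ha, hc]
  intro F hF hb
  subst hb
  obtain ⟨G, hG, hcard, hreg⟩ := exists_oospc_two_mul (Nat.odd_iff.2 (by omega))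
    (Nat.odd_iff.2 (by omega)) hF
  exact ⟨⟨G, hG, hcard⟩, fun s t hR => ⟨G, hG, hcard, hreg s t hR⟩⟩
end
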